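/- arXiv:1501.02418 — 2 statements merged into one kernel-verified Lean document; each statement's English description precedes it below -/
import Mathlib

section
/- For finitely presentable groups G_1 and G_2, the stable presentation length is additive under free products: T_∞(G_1 * G_2) = T_∞(G_1) + T_∞(G_2). -/
/-- The set of values `Σ_i max(0, |r_i| - 2)` attained by finite presentations of `G`. -/
def presLengthValues (G : Type*) [Group G] : Set ℕ :=
  { t | ∃ (n : ℕ) (rels : List (FreeGroup (Fin n))),
      Nonempty (G ≃* PresentedGroup {r | r ∈ rels}) ∧
      t = (rels.map (fun r => FreeGroup.norm r - 2)).sum }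

/-- A group is finitely presentable if it admits a finite presentation. -/
def FinitelyPresentable (G : Type*) [Group G] : Prop :=
  (presLengthValues G).Nonempty

/-- The presentation length (Delzant's T-invariant) of a group. -/
noncomputable def presLength (G : Type*) [Group G] : ℕ :=
  sInf (presLengthValues G)

/-- The stable presentation length of a group. -/
noncomputable def stablePresLength (G : Type*) [Group G] : ℝ :=
  sInf { x : ℝ | ∃ H : Subgroup G, H.index ≠ 0 ∧
      x = (presLength H : ℝ) / (H.index : ℝ) }


theorem presLengthValues_subset_of_mulEquiv {G G' : Type*} [Group G] [Group G'] (e : G ≃* G') :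
    presLengthValues G ⊆ presLengthValues G' := by
  rintro t ⟨n, rels, ⟨f⟩, ht⟩
  exact ⟨n, rels, ⟨e.symm.trans f⟩, ht⟩

theorem presLengthValues_congr {G G' : Type*} [Group G] [Group G'] (e : G ≃* G') :
    presLengthValues G = presLengthValues G' :=
  (presLengthValues_subset_of_mulEquiv e).antisymm (presLengthValues_subset_of_mulEquiv e.symm)

/-- A `Q`-valued function on pairs which is trivial on degenerate edges and compatible with
reversing edges. -/
structure IsAlternating {X Q : Type*} [Group Q] (c : X → X → Q) : Prop where
  diag : ∀ x, c x x = 1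
  mul_swap : ∀ x y, c x y * c y x = 1

theorem IsAlternating.swap {X Q : Type*} [Group Q] {c : X → X → Q} (hc : IsAlternating c)
    (x y : X) : c y x = (c x y)⁻¹ :=
  (inv_eq_of_mul_eq_one_right (hc.mul_swap x y)).symm

/-- The sum of a cochain over the boundary of a triangle. -/
def boundaryProd {X Q : Type*} [Group Q] (c : X → X → Q) (x y z : X) : Q :=
  c x y * c y z * c z x

/-- In a connected graph with a free action, a connected fundamental domain for the vertices. -/
theorem exists_connected_transversal {K X : Type*} [Group K] (ρ : K →* Equiv.Perm X)
    (E : X → X → Prop) (hE : ∀ k x y, E x y → E (ρ k x) (ρ k y)) (x₀ : X)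
    (hconn : ∀ P : X → Prop, P x₀ → (∀ x y, E x y → P x → P y) → ∀ x, P x) :
    ∃ D : Set X, x₀ ∈ D ∧ (∀ k, ∀ x ∈ D, ρ k x ∈ D → ρ k x = x) ∧
      (∀ P : X → Prop, P x₀ → (∀ x ∈ D, ∀ y ∈ D, E x y → P x → P y) → ∀ x ∈ D, P x) ∧
      ∀ x, ∃ k, ρ k x ∈ D := by
  let good : Set (Set X) := {D | x₀ ∈ D ∧ (∀ k, ∀ x ∈ D, ρ k x ∈ D → ρ k x = x) ∧
      (∀ P : X → Prop, P x₀ → (∀ x ∈ D, ∀ y ∈ D, E x y → P x → P y) → ∀ x ∈ D, P x)}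
  have hbase : ({x₀} : Set X) ∈ good := by
    refine ⟨rfl, ?_, ?_⟩
    · rintro k x rfl h
      exact h
    · rintro P h - x rfl
      exact h
  obtain ⟨D, -, hD⟩ := zorn_subset_nonempty good (by
    rintro C hC hchain ⟨D₀, hD₀⟩
    refine ⟨⋃₀ C, ⟨⟨D₀, hD₀, (hC hD₀).1⟩, ?_, ?_⟩, fun s hs => Set.subset_sUnion_of_mem hs⟩
    · rintro k x ⟨D₁, h₁, hx⟩ ⟨D₂, h₂, hx'⟩
      rcases hchain.total h₁ h₂ with h | h
      · exact (hC h₂).2.1 k x (h hx) hx'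
      · exact (hC h₁).2.1 k x hx (h hx')
    · rintro P h₀ hP x ⟨D₁, h₁, hx⟩
      exact (hC h₁).2.2 P h₀ (fun x hx y hy => hP x ⟨D₁, h₁, hx⟩ y ⟨D₁, h₁, hy⟩) x hx)
    {x₀} hbase
  obtain ⟨h₀, h₁, h₂⟩ := hD.prop
  refine ⟨D, h₀, h₁, h₂, hconn _ ⟨1, by simpa using h₀⟩ ?_⟩
  rintro x y hxy ⟨k, hk⟩
  by_contra! hy
  refine hy k (hD.le_of_ge (y := insert (ρ k y) D) ⟨?_, ?_, ?_⟩ (Set.subset_insert _ _)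
    (Set.mem_insert _ _))
  · exact Set.mem_insert_of_mem _ h₀
  · rintro l x (rfl | hx) (hl | hl)
    · exact hl
    · rw [← Equiv.Perm.mul_apply, ← map_mul] at hl
      exact absurd hl (hy _)
    · have : ρ (l⁻¹ * k) y = x := by
        rw [map_mul, Equiv.Perm.mul_apply, ← hl, map_inv, Equiv.Perm.inv_def,
          Equiv.symm_apply_apply]
      exact absurd (this ▸ hx) (hy _)
    · exact h₁ l x hx hl
  · intro P hP₀ hP
    have key : ∀ x ∈ D, P x := h₂ P hP₀ fun x hx y hy =>
      hP x (Set.mem_insert_of_mem _ hx) y (Set.mem_insert_of_mem _ hy)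
    rintro z (rfl | hz)
    · exact hP _ (Set.mem_insert_of_mem _ hk) _ (Set.mem_insert _ _) (hE k _ _ hxy) (key _ hk)
    · exact key z hz

/-- A group acting freely on the vertices of a simply connected triangular complex, with finitely
many orbits of edges, has presentation length at most the number of orbits of triangles. -/
theorem exists_presLengthValues_le {K X : Type*} [Group K] (ρ : K →* Equiv.Perm X)
    (hfree : ∀ k x, ρ k x = x → k = 1)
    (E : X → X → Prop) (hE : ∀ k x y, E x y → E (ρ k x) (ρ k y)) (hsymm : ∀ x y, E x y → E y x)
    (x₀ : X) (hconn : ∀ P : X → Prop, P x₀ → (∀ x y, E x y → P x → P y) → ∀ x, P x)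
    (F : Set (X × X)) (hF : F.Finite) (hEF : ∀ x y, E x y → ∃ k, (ρ k x, ρ k y) ∈ F)
    (R : Finset (X × X × X)) (hR : ∀ t ∈ R, E t.1 t.2.1 ∧ E t.2.1 t.2.2 ∧ E t.2.2 t.1)
    (hsc : ∀ (Q : Type) [Group Q] (c : X → X → Q), IsAlternating c →
      (∀ k, ∀ t ∈ R, boundaryProd c (ρ k t.1) (ρ k t.2.1) (ρ k t.2.2) = 1) →
      ∃ h : X → Q, ∀ x y, E x y → c x y = (h x)⁻¹ * h y) :
    ∃ t ∈ presLengthValues K, t ≤ R.card := by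
  classical
  obtain ⟨D, hx₀, hD₁, hDconn, hD⟩ := exists_connected_transversal ρ E hE x₀ hconn
  choose τ hτ using hD
  let σ : X → K := fun x => (τ x)⁻¹
  have hσuniq : ∀ k x, ρ k x ∈ D → σ x = k⁻¹ := by
    intro k x hk
    have h1 : ρ (τ x * k⁻¹) (ρ k x) = ρ (τ x) x := by
      rw [← Equiv.Perm.mul_apply, ← map_mul, inv_mul_cancel_right]
    have := hD₁ (τ x * k⁻¹) (ρ k x) hk (h1 ▸ hτ x)
    have := hfree _ _ this
    simp only [σ]
    rw [mul_inv_eq_one.1 this]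
  have hσD : ∀ x ∈ D, σ x = 1 := fun x hx => by simpa using hσuniq 1 x (by simpa using hx)
  have hσmul : ∀ k x, σ (ρ k x) = k * σ x := by
    intro k x
    have : ρ (τ x * k⁻¹) (ρ k x) ∈ D := by
      rw [← Equiv.Perm.mul_apply, ← map_mul, inv_mul_cancel_right]
      exact hτ x
    rw [hσuniq _ _ this]
    simp [σ]
  have hστ : ∀ x, ∃ d ∈ D, x = ρ (σ x) d := fun x => ⟨_, hτ x, by simp [σ]⟩
  -- orbits of pairs of vertices
  let r : Setoid (X × X) :=
    { r := fun p q => ∃ k, (ρ k p.1, ρ k p.2) = q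
      iseqv := ⟨fun p => ⟨1, by simp⟩, by
          rintro p q ⟨k, rfl⟩
          exact ⟨k⁻¹, by simp⟩, by
          rintro p q s ⟨k, rfl⟩ ⟨l, rfl⟩
          exact ⟨l * k, by simp⟩⟩ }
  let o : X → X → Quotient r := fun x y => Quotient.mk r (x, y)
  have ho : ∀ k x y, o (ρ k x) (ρ k y) = o x y := fun k x y =>
    (Quotient.sound (s := r) ⟨k, rfl⟩ : Quotient.mk r (x, y) = _).symm
  let Eo : Set (Quotient r) := {q | ∃ x y, E x y ∧ o x y = q}
  have hEofin : Eo.Finite := by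
    refine (hF.image (fun p => Quotient.mk r p)).subset ?_
    rintro _ ⟨x, y, hxy, rfl⟩
    obtain ⟨k, hk⟩ := hEF x y hxy
    exact ⟨_, hk, ho k x y⟩
  have hmem : ∀ x y, o x y ∈ Eo ↔ E x y := by
    refine fun x y => ⟨?_, fun h => ⟨x, y, h, rfl⟩⟩
    rintro ⟨x', y', h, h'⟩
    obtain ⟨k, hk⟩ := Quotient.exact h'
    simp only [Prod.mk.injEq] at hk
    rw [← hk.1, ← hk.2]
    exact hE k _ _ h
  have : Finite Eo := hEofin
  obtain ⟨n, ⟨ε⟩⟩ := Finite.exists_equiv_fin Eo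
  let w : X → X → FreeGroup (Fin n) := fun x y =>
    if h : o x y ∈ Eo then FreeGroup.of (ε ⟨o x y, h⟩) else 1
  have hwρ : ∀ k x y, w (ρ k x) (ρ k y) = w x y := by
    intro k x y
    simp only [w, ho]
  have hwnorm : ∀ x y, (w x y).norm ≤ 1 := by
    intro x y
    simp only [w]
    split_ifs <;> simp
  let px : Fin n → X := fun i => (Quotient.out (ε.symm i).1).1
  let py : Fin n → X := fun i => (Quotient.out (ε.symm i).1).2
  have hpo : ∀ i, o (px i) (py i) = (ε.symm i).1 := fun i => Quotient.out_eq _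
  have hpE : ∀ i, E (px i) (py i) := fun i => by
    rw [← hmem, hpo]
    exact (ε.symm i).2
  have hpw : ∀ i, w (px i) (py i) = FreeGroup.of i := by
    intro i
    simp only [w, hpo, Subtype.coe_prop, dite_true, Subtype.coe_eta, Equiv.apply_symm_apply]
  have hEp : ∀ x y, E x y → ∃ i k, x = ρ k (px i) ∧ y = ρ k (py i) := by
    intro x y hxy
    refine ⟨ε ⟨o x y, (hmem x y).2 hxy⟩, ?_⟩
    have := hpo (ε ⟨o x y, (hmem x y).2 hxy⟩)
    rw [Equiv.symm_apply_apply] at this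
    obtain ⟨k, hk⟩ := Quotient.exact this
    simp only [Prod.mk.injEq] at hk
    exact ⟨k, hk.1.symm, hk.2.symm⟩
  let rels : List (FreeGroup (Fin n)) :=
    ((List.finRange n).map fun i => w (px i) (py i) * w (py i) (px i)) ++
    (((List.finRange n).filter fun i => σ (px i) = σ (py i)).map fun i => w (px i) (py i)) ++
    (R.toList.map fun t => boundaryProd w t.1 t.2.1 t.2.2)
  refine ⟨_, ⟨n, rels, ?_, rfl⟩, ?_⟩
  swap
  · have h1 : ∀ (l : List (FreeGroup (Fin n))), (∀ r ∈ l, FreeGroup.norm r ≤ 2) →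
        (l.map (fun r => FreeGroup.norm r - 2)).sum = 0 := by
      intro l hl
      rw [List.sum_eq_zero_iff]
      simp only [List.mem_map]
      rintro _ ⟨r, hr, rfl⟩
      have := hl r hr
      omega
    have h2 : ∀ (l : List (FreeGroup (Fin n))), (∀ r ∈ l, FreeGroup.norm r ≤ 3) →
        (l.map (fun r => FreeGroup.norm r - 2)).sum ≤ l.length := by
      intro l hl
      have := List.sum_le_card_nsmul (l.map (fun r => FreeGroup.norm r - 2)) 1 (by
        simp only [List.mem_map]
        rintro _ ⟨r, hr, rfl⟩
        have := hl r hr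
        omega)
      simpa using this
    simp only [rels, List.map_append, List.sum_append]
    rw [h1, h1, zero_add, zero_add]
    · refine (h2 _ ?_).trans (by rw [List.length_map, Finset.length_toList])
      simp only [List.mem_map]
      rintro _ ⟨t, -, rfl⟩
      refine (FreeGroup.norm_mul_le _ _).trans ?_
      have := FreeGroup.norm_mul_le (w t.1 t.2.1) (w t.2.1 t.2.2)
      have := hwnorm t.1 t.2.1
      have := hwnorm t.2.1 t.2.2
      have := hwnorm t.2.2 t.1
      omega
    · simp only [List.mem_map]
      rintro _ ⟨i, -, rfl⟩
      exact (hwnorm _ _).trans one_le_two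
    · simp only [List.mem_map]
      rintro _ ⟨i, -, rfl⟩
      refine (FreeGroup.norm_mul_le _ _).trans ?_
      have := hwnorm (px i) (py i)
      have := hwnorm (py i) (px i)
      omega
  let Q := PresentedGroup {r | r ∈ rels}
  let c : X → X → Q := fun x y => PresentedGroup.mk _ (w x y)
  have hrel : ∀ r ∈ rels, PresentedGroup.mk {r | r ∈ rels} r = 1 := fun r hr =>
    PresentedGroup.one_of_mem hr
  have hcρ : ∀ k x y, c (ρ k x) (ρ k y) = c x y := fun k x y => by simp only [c, hwρ]
  have hcE : ∀ x y, ¬ E x y → c x y = 1 := by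
    intro x y h
    simp only [c, w, hmem, h, dite_false, map_one]
  have hcσ : ∀ x y, σ x = σ y → c x y = 1 := by
    intro x y h
    by_cases hxy : E x y
    · obtain ⟨i, k, rfl, rfl⟩ := hEp x y hxy
      rw [hσmul, hσmul, mul_right_inj] at h
      rw [hcρ]
      apply hrel
      simp only [rels, List.mem_append, List.mem_map, List.mem_filter]
      exact Or.inl (Or.inr ⟨i, ⟨List.mem_finRange i, by simpa using h⟩, rfl⟩)
    · exact hcE x y hxy
  have hcalt : IsAlternating c := by
    refine ⟨fun x => hcσ x x rfl, fun x y => ?_⟩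
    by_cases hxy : E x y
    · obtain ⟨i, k, rfl, rfl⟩ := hEp x y hxy
      rw [hcρ, hcρ]
      simp only [c]
      rw [← map_mul]
      apply hrel
      simp only [rels, List.mem_append, List.mem_map]
      exact Or.inl (Or.inl ⟨i, List.mem_finRange i, rfl⟩)
    · rw [hcE x y hxy, hcE y x fun h => hxy (hsymm _ _ h), one_mul]
  obtain ⟨h', hh'⟩ := hsc Q c hcalt (by
    intro k t ht
    simp only [boundaryProd, hcρ]
    simp only [c]
    rw [← map_mul, ← map_mul]
    apply hrel
    simp only [rels, List.mem_append, List.mem_map]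
    exact Or.inr ⟨t, by simpa using ht, rfl⟩)
  let h : X → Q := fun x => (h' x₀)⁻¹ * h' x
  have hh₀ : h x₀ = 1 := inv_mul_cancel _
  have hh : ∀ x y, E x y → h y = h x * c x y := by
    intro x y hxy
    rw [hh' x y hxy]
    simp only [h]
    group
  have hhρ : ∀ k x, h (ρ k x) = h (ρ k x₀) * h x := by
    intro k
    refine hconn _ (by rw [hh₀, mul_one]) ?_
    intro x y hxy hx
    rw [hh _ _ (hE k _ _ hxy), hcρ, hx, hh _ _ hxy, mul_assoc]
  have hhD : ∀ x ∈ D, h x = 1 := hDconn _ hh₀ fun x hx y hy hxy hx1 => by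
    rw [hh _ _ hxy, hx1, hcσ x y (by rw [hσD x hx, hσD y hy]), one_mul]
  let φ : K →* Q :=
    { toFun := fun k => h (ρ k x₀)
      map_one' := by simpa using hh₀
      map_mul' := fun k l => by rw [map_mul, Equiv.Perm.mul_apply, hhρ k] }
  have hhφ : ∀ x, h x = φ (σ x) := by
    intro x
    obtain ⟨d, hd, hx⟩ := hστ x
    conv_lhs => rw [hx, hhρ, hhD d hd, mul_one]
    rfl
  let lab : Fin n → K := fun i => (σ (px i))⁻¹ * σ (py i)
  have hlabw : ∀ x y, E x y → FreeGroup.lift lab (w x y) = (σ x)⁻¹ * σ y := by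
    intro x y hxy
    obtain ⟨i, k, rfl, rfl⟩ := hEp x y hxy
    rw [hwρ, hpw, FreeGroup.lift_apply_of, hσmul, hσmul]
    simp only [lab]
    group
  let lam : Q →* K := PresentedGroup.toGroup (f := lab) (by
    intro r hr
    simp only [rels, List.mem_append, List.mem_map, Set.mem_ofPred_eq, List.mem_filter] at hr
    rcases hr with (⟨i, -, rfl⟩ | ⟨i, ⟨-, hi⟩, rfl⟩) | ⟨t, ht, rfl⟩
    · rw [map_mul, hlabw _ _ (hpE i), hlabw _ _ (hsymm _ _ (hpE i))]
      group
    · rw [hlabw _ _ (hpE i), of_decide_eq_true hi]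
      group
    · obtain ⟨h1, h2, h3⟩ := hR t (by simpa using ht)
      simp only [boundaryProd]
      rw [map_mul, map_mul, hlabw _ _ h1, hlabw _ _ h2, hlabw _ _ h3]
      group)
  have hlamc : ∀ x y, E x y → lam (c x y) = (σ x)⁻¹ * σ y := fun x y hxy => hlabw x y hxy
  have hlamh : ∀ x, lam (h x) = σ x := by
    refine hconn _ (by rw [hh₀, map_one, hσD _ hx₀]) ?_
    intro x y hxy hx
    rw [hh _ _ hxy, map_mul, hx, hlamc _ _ hxy, mul_inv_cancel_left]
  refine ⟨MonoidHom.toMulEquiv φ lam ?_ ?_⟩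
  · ext k
    change lam (h (ρ k x₀)) = k
    rw [hlamh, hσmul, hσD _ hx₀, mul_one]
  · refine PresentedGroup.ext fun i => ?_
    have h1 : (PresentedGroup.of i : Q) = c (px i) (py i) := by
      simp only [c, hpw]
      rfl
    change φ (lam (PresentedGroup.of i)) = PresentedGroup.of i
    rw [h1, hlamc _ _ (hpE i), map_mul, map_inv, ← hhφ, ← hhφ, hh _ _ (hpE i),
      inv_mul_cancel_left]

/-- `S` is a finite symmetric generating set of `G` and `R` a finite set of pairs `(a, b)` with
`a, b, a * b ∈ S`, such that the Cayley complex with edges `(x, x * s)` and triangles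
`(x, x * a, x * a * b)` is simply connected. -/
structure IsTriangulation {G : Type*} [Group G] (S : Set G) (R : Finset (G × G)) : Prop where
  finite : S.Finite
  inv_mem : ∀ s ∈ S, s⁻¹ ∈ S
  mem : ∀ r ∈ R, r.1 ∈ S ∧ r.2 ∈ S ∧ r.1 * r.2 ∈ S
  induction : ∀ P : G → Prop, P 1 → (∀ x, ∀ s ∈ S, P x → P (x * s)) → ∀ x, P x
  exists_potential : ∀ (Q : Type) [Group Q] (c : G → G → Q), IsAlternating c →
    (∀ x, ∀ r ∈ R, boundaryProd c x (x * r.1) (x * r.1 * r.2) = 1) →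
    ∃ h : G → Q, ∀ x, ∀ s ∈ S, c x (x * s) = (h x)⁻¹ * h (x * s)

/-- Lifting right multiplication by `g` along a cochain. -/
def cochainStep {G Q : Type*} [Group G] [Group Q] {c : G → G → Q} (hc : IsAlternating c) (g : G) :
    Equiv.Perm (G × Q) where
  toFun p := (p.1 * g, p.2 * c p.1 (p.1 * g))
  invFun p := (p.1 * g⁻¹, p.2 * c p.1 (p.1 * g⁻¹))
  left_inv p := by simp [mul_assoc, hc.mul_swap]
  right_inv p := by simp [mul_assoc, hc.mul_swap]

theorem exists_isTriangulation {G : Type*} [Group G] {t : ℕ} (ht : t ∈ presLengthValues G) :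
    ∃ (S : Set G) (R : Finset (G × G)), IsTriangulation S R ∧ R.card ≤ t := by
  classical
  obtain ⟨n, rels, ⟨e⟩, rfl⟩ := ht
  let f : FreeGroup (Fin n) →* G := e.symm.toMonoidHom.comp (PresentedGroup.mk {r | r ∈ rels})
  have hfsurj : Function.Surjective f := e.symm.surjective.comp (PresentedGroup.mk_surjective _)
  have hfker : ∀ w, f w = 1 → w ∈ Subgroup.normalClosure {r | r ∈ rels} := by
    intro w hw
    have : PresentedGroup.mk {r | r ∈ rels} w = 1 :=
      e.symm.injective (by rw [map_one]; exact hw)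
    exact (QuotientGroup.eq_one_iff w).1 this
  have hfrel : ∀ r ∈ rels, f r = 1 := by
    intro r hr
    have : PresentedGroup.mk {r | r ∈ rels} r = 1 := PresentedGroup.one_of_mem hr
    change e.symm (PresentedGroup.mk {r | r ∈ rels} r) = 1
    rw [this, map_one]
  let pre : FreeGroup (Fin n) → ℕ → FreeGroup (Fin n) := fun r i => FreeGroup.mk (r.toWord.take i)
  let let' : FreeGroup (Fin n) → ℕ → FreeGroup (Fin n) := fun r i =>
    FreeGroup.mk ((r.toWord.drop i).take 1)
  have hpre : ∀ r i, pre r (i + 1) = pre r i * let' r i := by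
    intro r i
    simp only [pre, let', FreeGroup.mul_mk, List.take_add]
  have hpre0 : ∀ r, pre r 0 = 1 := fun r => rfl
  have hprelen : ∀ r, pre r r.norm = r := by
    intro r
    simp only [pre, FreeGroup.norm, List.take_length, FreeGroup.mk_toWord]
  let S₀ : Set G := (Set.range fun i => f (FreeGroup.of i)) ∪
    ⋃ r ∈ {r | r ∈ rels}, ((fun i => f (pre r i)) '' Set.Iic r.norm ∪
      (fun i => f (let' r i)) '' Set.Iic r.norm)
  have hS₀fin : S₀.Finite := by
    refine (Set.finite_range _).union (rels.finite_toSet.biUnion fun r _ => ?_)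
    exact ((Set.finite_Iic _).image _).union ((Set.finite_Iic _).image _)
  have hpreS : ∀ r ∈ rels, ∀ i ≤ r.norm, f (pre r i) ∈ S₀ := fun r hr i hi =>
    Or.inr (Set.mem_biUnion (show r ∈ {r | r ∈ rels} from hr) (Or.inl ⟨i, hi, rfl⟩))
  have hletS : ∀ r ∈ rels, ∀ i ≤ r.norm, f (let' r i) ∈ S₀ := fun r hr i hi =>
    Or.inr (Set.mem_biUnion (show r ∈ {r | r ∈ rels} from hr) (Or.inr ⟨i, hi, rfl⟩))
  let R : Finset (G × G) := (rels.flatMap fun r =>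
    (List.range' 1 (r.norm - 2)).map fun i => (f (pre r i), f (let' r i))).toFinset
  have hR : ∀ p, p ∈ R ↔ ∃ r ∈ rels, ∃ i, 1 ≤ i ∧ i + 1 < r.norm ∧
      p = (f (pre r i), f (let' r i)) := by
    intro p
    simp only [R, List.mem_toFinset, List.mem_flatMap, List.mem_map, List.mem_range'_1]
    constructor
    · rintro ⟨r, hr, i, hi, rfl⟩
      exact ⟨r, hr, i, hi.1, by omega, rfl⟩
    · rintro ⟨r, hr, i, h1, h2, rfl⟩
      exact ⟨r, hr, i, by omega, rfl⟩
  refine ⟨S₀ ∪ S₀⁻¹, R, ⟨hS₀fin.union hS₀fin.inv, ?_, ?_, ?_, ?_⟩, ?_⟩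
  · rintro s (hs | hs)
    · exact Or.inr (by simpa using hs)
    · exact Or.inl hs
  · intro p hp
    obtain ⟨r, hr, i, h1, h2, rfl⟩ := (hR p).1 hp
    refine ⟨Or.inl (hpreS r hr i (by omega)), Or.inl (hletS r hr i (by omega)), Or.inl ?_⟩
    rw [← map_mul, ← hpre]
    exact hpreS r hr _ (by omega)
  · intro P h1 hP x
    obtain ⟨w, rfl⟩ := hfsurj x
    have key : ∀ y, P y → P (y * f w) := by
      induction w using FreeGroup.induction_on with
      | C1 => simp
      | of i => exact fun y hy => hP y _ (Or.inl (Or.inl ⟨i, rfl⟩)) hy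
      | inv_of i _ =>
        refine fun y hy => hP y _ (Or.inr (Or.inl ⟨i, ?_⟩)) hy
        simp
      | mul u v hu hv =>
        intro y hy
        rw [map_mul, ← mul_assoc]
        exact hv _ (hu _ hy)
    simpa using key 1 h1
  · intro Q _ c hc hcR
    let Φ : FreeGroup (Fin n) →* (Equiv.Perm (G × Q))ᵐᵒᵖ :=
      FreeGroup.lift fun i => MulOpposite.op (cochainStep hc (f (FreeGroup.of i)))
    let act : FreeGroup (Fin n) → G × Q → G × Q := fun w p => (Φ w).unop p
    have hact_mul : ∀ w w' p, act (w * w') p = act w' (act w p) := by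
      intro w w' p
      simp only [act, map_mul, MulOpposite.unop_mul, Equiv.Perm.mul_apply]
    have hact_one : ∀ p, act 1 p = p := by
      intro p
      simp only [act, map_one, MulOpposite.unop_one, Equiv.Perm.coe_one, id_eq]
    have hact_of : ∀ i x q, act (FreeGroup.of i) (x, q) =
        (x * f (FreeGroup.of i), q * c x (x * f (FreeGroup.of i))) := by
      intro i x q
      simp only [act, Φ, FreeGroup.lift_apply_of, MulOpposite.unop_op]
      rfl
    have hact_inv : ∀ i x q, act (FreeGroup.of i)⁻¹ (x, q) =
        (x * f (FreeGroup.of i)⁻¹, q * c x (x * f (FreeGroup.of i)⁻¹)) := by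
      intro i x q
      simp only [act, Φ, map_inv, FreeGroup.lift_apply_of, MulOpposite.unop_op,
        MulOpposite.unop_inv]
      rfl
    have hact_fst : ∀ w p, (act w p).1 = p.1 * f w := by
      intro w
      induction w using FreeGroup.induction_on with
      | C1 => intro p; rw [hact_one, map_one, mul_one]
      | of i => exact fun p => by rw [hact_of]
      | inv_of i _ => exact fun p => by rw [hact_inv]
      | mul u v hu hv => intro p; rw [hact_mul, hv, hu, map_mul, mul_assoc]
    have hact_let : ∀ r i x q, act (let' r i) (x, q) =
        (x * f (let' r i), q * c x (x * f (let' r i))) := by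
      intro r i x q
      have hl : ((r.toWord.drop i).take 1).length ≤ 1 := by
        rw [List.length_take]
        exact min_le_left _ _
      simp only [let']
      generalize (r.toWord.drop i).take 1 = l at hl
      match l, hl with
      | [], _ =>
        rw [← FreeGroup.one_eq_mk, hact_one, map_one, mul_one, hc.diag, mul_one]
      | [(i, true)], _ => exact hact_of i x q
      | [(i, false)], _ => exact hact_inv i x q
    have hact_pre : ∀ r ∈ rels, ∀ i ≤ r.norm, ∀ x q, act (pre r i) (x, q) =
        (x * f (pre r i), q * c x (x * f (pre r i))) := by
      intro r hr i
      induction i with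
      | zero =>
        intro _ x q
        rw [hpre0, hact_one, map_one, mul_one, hc.diag, mul_one]
      | succ i ih =>
        intro hi x q
        rw [hpre, hact_mul, ih (by omega), hact_let, map_mul, mul_assoc x, mul_assoc q]
        congr 2
        rcases Nat.eq_zero_or_pos i with rfl | hi0
        · rw [hpre0, map_one, mul_one, hc.diag, one_mul, one_mul]
        rcases hi.eq_or_lt with h | h
        · rw [← map_mul, ← hpre, h, hprelen, hfrel r hr, mul_one, hc.mul_swap, hc.diag]
        · have := hcR x (f (pre r i), f (let' r i)) ((hR _).2 ⟨r, hr, i, hi0, h, rfl⟩)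
          simp only [boundaryProd, mul_assoc x] at this
          rw [mul_eq_one_iff_eq_inv.1 this, hc.swap, inv_inv]
    have hΦ : ∀ w, f w = 1 → Φ w = 1 := by
      intro w hw
      have hle : Subgroup.normalClosure {r | r ∈ rels} ≤ Φ.ker := by
        refine Subgroup.normalClosure_le_normal fun r hr => ?_
        have h1 := hact_pre r hr _ le_rfl
        rw [hprelen, hfrel r hr] at h1
        refine MulOpposite.unop_injective (Equiv.ext fun p => ?_)
        change act r p = p
        rw [h1, mul_one, hc.diag, mul_one]
      exact hle (hfker w hw)
    choose lft hlft using hfsurj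
    have hlift : ∀ w, Φ (lft (f w)) = Φ w := by
      intro w
      have := hΦ (lft (f w) * w⁻¹) (by rw [map_mul, hlft, map_inv, mul_inv_cancel])
      rwa [map_mul, map_inv, mul_inv_eq_one] at this
    let h : G → Q := fun x => (act (lft x) (1, 1)).2
    have hh : ∀ w x, act w (x, h x) = (x * f w, h (x * f w)) := by
      intro w x
      have h1 : ∀ x, act (lft x) (1, 1) = (x, h x) := fun x =>
        Prod.ext (by rw [hact_fst, one_mul, hlft]) rfl
      rw [← h1, ← h1, ← hact_mul]
      have h2 : f (lft x * w) = x * f w := by rw [map_mul, hlft]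
      simp only [act]
      rw [← h2, hlift]
    have hS₀ : ∀ x, ∀ s ∈ S₀, c x (x * s) = (h x)⁻¹ * h (x * s) := by
      have aux : ∀ w x, act w (x, h x) = (x * f w, h x * c x (x * f w)) →
          c x (x * f w) = (h x)⁻¹ * h (x * f w) := by
        intro w x hw
        rw [hh, Prod.mk.injEq] at hw
        rw [hw.2, inv_mul_cancel_left]
      rintro x s (⟨i, rfl⟩ | hs)
      · exact aux _ _ (hact_of i x _)
      · obtain ⟨r, hr, ⟨i, hi, rfl⟩ | ⟨i, hi, rfl⟩⟩ := Set.mem_iUnion₂.1 hs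
        · exact aux _ _ (hact_pre r hr i hi x _)
        · exact aux _ _ (hact_let r i x _)
    refine ⟨h, ?_⟩
    rintro x s (hs | hs)
    · exact hS₀ x s hs
    · have := hS₀ (x * s) _ hs
      rw [mul_inv_cancel_right] at this
      rw [hc.swap, this]
      group
  · refine (List.toFinset_card_le _).trans (le_of_eq ?_)
    rw [List.length_flatMap]
    simp

theorem IsTriangulation.nonempty_presLengthValues {G : Type*} [Group G] {S : Set G}
    {R : Finset (G × G)} (hT : IsTriangulation S R) (H : Subgroup G) (hH : H.index ≠ 0) :
    (presLengthValues H).Nonempty := by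
  classical
  have : H.FiniteIndex := ⟨hH⟩
  let T : Set G := Set.range fun q : G ⧸ H => q.out⁻¹
  have hTfin : T.Finite := Set.finite_range _
  have hHT : ∀ x : G, ∃ k : H, (k : G) * x ∈ T := by
    intro x
    obtain ⟨k, hk⟩ := QuotientGroup.mk_out_eq_mul H x⁻¹
    exact ⟨k⁻¹, (x⁻¹ : G), by simp [hk]⟩
  let E : G → G → Prop := fun x y => ∃ s ∈ S, y = x * s
  obtain ⟨t, ht, -⟩ := exists_presLengthValues_le (MulAction.toPermHom H G)
    (fun k x h => by simpa [Subgroup.smul_def] using h) E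
    (by
      rintro k x _ ⟨s, hs, rfl⟩
      exact ⟨s, hs, (mul_assoc _ _ _).symm⟩)
    (by
      rintro x _ ⟨s, hs, rfl⟩
      exact ⟨s⁻¹, hT.inv_mem s hs, by group⟩)
    1
    (fun P h1 hP => hT.induction P h1 fun x s hs hx => hP x _ ⟨s, hs, rfl⟩ hx)
    {p | p.1 ∈ T ∧ E p.1 p.2}
    (((hTfin.prod hT.finite).image fun p => (p.1, p.1 * p.2)).subset (by
      rintro ⟨x, y⟩ ⟨hx, s, hs, hy⟩
      exact ⟨(x, s), ⟨hx, hs⟩, Prod.ext rfl hy.symm⟩))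
    (by
      rintro x _ ⟨s, hs, rfl⟩
      obtain ⟨k, hk⟩ := hHT x
      exact ⟨k, hk, s, hs, (mul_assoc _ _ _).symm⟩)
    ((hTfin.toFinset ×ˢ R).image fun p => (p.1, p.1 * p.2.1, p.1 * p.2.1 * p.2.2))
    (by
      intro t ht
      obtain ⟨⟨x, r⟩, hr, rfl⟩ := Finset.mem_image.1 ht
      obtain ⟨h1, h2, h3⟩ := hT.mem r (Finset.mem_product.1 hr).2
      exact ⟨⟨_, h1, rfl⟩, ⟨_, h2, rfl⟩, ⟨_, hT.inv_mem _ h3, by group⟩⟩)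
    (by
      intro Q _ c hc hcR
      obtain ⟨h, hh⟩ := hT.exists_potential Q c hc (by
        intro x r hr
        obtain ⟨k, hk⟩ := hHT x
        have := hcR k⁻¹ _ (Finset.mem_image_of_mem
          (fun p : G × G × G => (p.1, p.1 * p.2.1, p.1 * p.2.1 * p.2.2))
          (Finset.mem_product.2 ⟨hTfin.mem_toFinset.2 hk, hr⟩ :
            ((k : G) * x, r) ∈ hTfin.toFinset ×ˢ R))
        simpa [Subgroup.smul_def, mul_assoc] using this)
      refine ⟨h, ?_⟩
      rintro x _ ⟨s, hs, rfl⟩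
      exact hh x s hs)
  exact ⟨t, ht⟩

/-- The action of a monoid on `G × Q` obtained by lifting right multiplication along a cocycle. -/
def cocycleHom {M G Q : Type*} [Monoid M] [Group G] [Group Q] (φ : M →* G) (c : G → G → Q)
    (hc : ∀ x a b, c x (x * φ a) * c (x * φ a) (x * φ a * φ b) = c x (x * φ a * φ b)) :
    M →* (Function.End (G × Q))ᵐᵒᵖ where
  toFun a := MulOpposite.op fun p => (p.1 * φ a, p.2 * c p.1 (p.1 * φ a))
  map_one' := by
    refine MulOpposite.unop_injective (funext fun p => ?_)
    have := hc p.1 1 1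
    simp only [map_one, mul_one, mul_eq_left] at this
    change (p.1 * φ 1, p.2 * c p.1 (p.1 * φ 1)) = p
    rw [map_one, mul_one, this, mul_one]
  map_mul' a b := by
    refine MulOpposite.unop_injective (funext fun p => ?_)
    have := hc p.1 a b
    change (p.1 * φ (a * b), p.2 * c p.1 (p.1 * φ (a * b))) =
      (p.1 * φ a * φ b, p.2 * c p.1 (p.1 * φ a) * c (p.1 * φ a) (p.1 * φ a * φ b))
    rw [map_mul, ← mul_assoc, ← this, mul_assoc p.2]

open Monoid (Coprod)

/-- The two free factors of a free product. -/
def freeFactor (G₁ G₂ : Type*) [Group G₁] [Group G₂] : Bool → Subgroup (Coprod G₁ G₂)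
  | true => (Coprod.inl : G₁ →* Coprod G₁ G₂).range
  | false => (Coprod.inr : G₂ →* Coprod G₁ G₂).range

section Coprod

variable {G₁ G₂ : Type*} [Group G₁] [Group G₂]

theorem coprod_induction_right (P : Coprod G₁ G₂ → Prop) (h1 : P 1)
    (hP : ∀ i x, ∀ a ∈ freeFactor G₁ G₂ i, P x → P (x * a)) (x : Coprod G₁ G₂) : P x := by
  have key : ∀ y, P y → P (y * x) := by
    induction x using Coprod.induction_on with
    | inl a => exact fun y hy => hP true y _ ⟨a, rfl⟩ hy
    | inr a => exact fun y hy => hP false y _ ⟨a, rfl⟩ hy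
    | mul u v hu hv =>
      intro y hy
      rw [← mul_assoc]
      exact hv _ (hu _ hy)
  simpa using key 1 h1

/-- A tree of groups with trivial edge groups is simply connected: cocycles on the cosets of the
free factors come from a common potential. -/
theorem coprod_exists_potential {Q : Type*} [Group Q]
    (c : Bool → Coprod G₁ G₂ → Coprod G₁ G₂ → Q)
    (hc : ∀ i x, ∀ a ∈ freeFactor G₁ G₂ i, ∀ b ∈ freeFactor G₁ G₂ i,
      c i x (x * a) * c i (x * a) (x * a * b) = c i x (x * a * b)) :
    ∃ h : Coprod G₁ G₂ → Q, h 1 = 1 ∧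
      ∀ i x, ∀ a ∈ freeFactor G₁ G₂ i, h (x * a) = h x * c i x (x * a) := by
  let Φ : Coprod G₁ G₂ →* (Function.End (Coprod G₁ G₂ × Q))ᵐᵒᵖ :=
    Coprod.lift
      (cocycleHom Coprod.inl (c true) fun x a b => hc true x _ ⟨a, rfl⟩ _ ⟨b, rfl⟩)
      (cocycleHom Coprod.inr (c false) fun x a b => hc false x _ ⟨a, rfl⟩ _ ⟨b, rfl⟩)
  have hΦ : ∀ i x q, ∀ a ∈ freeFactor G₁ G₂ i,
      (Φ a).unop (x, q) = (x * a, q * c i x (x * a)) := by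
    rintro (_ | _) x q _ ⟨a, rfl⟩
    · simp only [Φ, Coprod.lift_apply_inr]
      rfl
    · simp only [Φ, Coprod.lift_apply_inl]
      rfl
  have hmul : ∀ x y p, (Φ (x * y)).unop p = (Φ y).unop ((Φ x).unop p) := by
    intro x y p
    rw [map_mul]
    rfl
  have hfst : ∀ x, ((Φ x).unop (1, 1)).1 = x := by
    refine coprod_induction_right _ (by rw [map_one]; rfl) ?_
    intro i x a ha hx
    rw [hmul, ← Prod.mk.eta (p := (Φ x).unop (1, 1)), hΦ i _ _ a ha, hx]
  refine ⟨fun x => ((Φ x).unop (1, 1)).2, by simp only [map_one]; rfl, ?_⟩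
  intro i x a ha
  simp only
  rw [hmul, ← Prod.mk.eta (p := (Φ x).unop (1, 1)), hΦ i _ _ a ha, hfst]

/-- Nearest point projections from the edges of the Bass–Serre tree, identified with the elements of
the free product, to the links of the two base vertices. -/
theorem exists_projection : ∃ π : Bool → Coprod G₁ G₂ → Coprod G₁ G₂,
    (∀ i, ∀ a ∈ freeFactor G₁ G₂ i, ∀ x, π i (a * x) = a * π i x) ∧
    (∀ i j x, ∀ b ∈ freeFactor G₁ G₂ j, π i (x * b) ≠ π i x →
      i = j ∧ x ∈ freeFactor G₁ G₂ i) := by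
  classical
  let A := freeFactor G₁ G₂
  let c : Bool → Bool → Coprod G₁ G₂ → Coprod G₁ G₂ → Coprod G₁ G₂ := fun i j x y =>
    if i = j ∧ x ∈ A i then x⁻¹ * y else 1
  have hc : ∀ i j x, ∀ a ∈ A j, ∀ b ∈ A j,
      c i j x (x * a) * c i j (x * a) (x * a * b) = c i j x (x * a * b) := by
    intro i j x a ha b hb
    by_cases h : i = j
    · subst h
      have : x * a ∈ A i ↔ x ∈ A i := Subgroup.mul_mem_cancel_right _ ha
      by_cases hx : x ∈ A i
      · simp [c, this, hx, mul_assoc]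
      · simp [c, this, hx]
    · simp [c, h]
  choose π hπ1 hπ using fun i => coprod_exists_potential (c i) (hc i)
  refine ⟨π, ?_, ?_⟩
  · intro i a ha
    refine coprod_induction_right _ ?_ ?_
    · have := hπ i i 1 a ha
      simp only [one_mul, hπ1] at this
      rw [mul_one, hπ1, mul_one, this]
      simp [c, one_mem]
    · intro j x b hb hx
      rw [← mul_assoc, hπ i j _ b hb, hx, hπ i j _ b hb, mul_assoc]
      congr 2
      simp only [c, Subgroup.mul_mem_cancel_left (A i) ha]
      congr 1
      group
  · intro i j x b hb h
    by_contra! hx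
    refine h ?_
    rw [hπ i j x b hb]
    have : ¬ (i = j ∧ x ∈ A i) := fun h => hx h.1 h.2
    simp only [c, this, if_false, mul_one]

end Coprod

section Coprod

variable {G₁ G₂ : Type*} [Group G₁] [Group G₂]

/-- The action of a free product on the product of coset spaces of its factors, described by the
stabilizer `H` of the base point and the coordinates `p i` of the orbit map of the inverse. -/
theorem exists_productAction (L : ∀ i, Subgroup (freeFactor G₁ G₂ i)) :
    ∃ (H : Subgroup (Coprod G₁ G₂)) (p : ∀ i, Coprod G₁ G₂ → freeFactor G₁ G₂ i ⧸ L i),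
      H.index = (L true).index * (L false).index ∧
      (∀ i x (a : freeFactor G₁ G₂ i), p i (x * a) = a⁻¹ • p i x) ∧
      (∀ i j x (a : freeFactor G₁ G₂ j), i ≠ j → p i (x * a) = p i x) ∧
      (∀ x y, y * x⁻¹ ∈ H ↔ ∀ i, p i x = p i y) ∧
      ∀ i (q : freeFactor G₁ G₂ i ⧸ L i) (q' : freeFactor G₁ G₂ (!i) ⧸ L (!i)),
        ∃ x, p i x = q ∧ p (!i) x = q' := by
  let Ω := (freeFactor G₁ G₂ true ⧸ L true) × (freeFactor G₁ G₂ false ⧸ L false)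
  let φ₁ : G₁ →* freeFactor G₁ G₂ true := (Coprod.inl : G₁ →* Coprod G₁ G₂).rangeRestrict
  let φ₂ : G₂ →* freeFactor G₁ G₂ false := (Coprod.inr : G₂ →* Coprod G₁ G₂).rangeRestrict
  let μ₁ : G₁ →* Function.End Ω :=
    { toFun := fun a ω => (φ₁ a • ω.1, ω.2)
      map_one' := by
        funext ω
        rw [map_one, one_smul]
        rfl
      map_mul' := fun a b => by
        funext ω
        rw [map_mul, mul_smul]
        rfl }
  let μ₂ : G₂ →* Function.End Ω :=
    { toFun := fun a ω => (ω.1, φ₂ a • ω.2)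
      map_one' := by
        funext ω
        rw [map_one, one_smul]
        rfl
      map_mul' := fun a b => by
        funext ω
        rw [map_mul, mul_smul]
        rfl }
  let _ : MulAction (Coprod G₁ G₂) Ω := MulAction.compHom Ω (Coprod.lift μ₁ μ₂)
  have htrue : ∀ (a : freeFactor G₁ G₂ true) (ω : Ω), (a : Coprod G₁ G₂) • ω = (a • ω.1, ω.2) := by
    rintro ⟨_, a, rfl⟩ ω
    change (Coprod.lift μ₁ μ₂ (Coprod.inl a)) ω = _
    rw [Coprod.lift_apply_inl]
    rfl
  have hfalse : ∀ (a : freeFactor G₁ G₂ false) (ω : Ω),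
      (a : Coprod G₁ G₂) • ω = (ω.1, a • ω.2) := by
    rintro ⟨_, a, rfl⟩ ω
    change (Coprod.lift μ₁ μ₂ (Coprod.inr a)) ω = _
    rw [Coprod.lift_apply_inr]
    rfl
  let ω₀ : Ω := ((1 : freeFactor G₁ G₂ true), (1 : freeFactor G₁ G₂ false))
  have hsurj : ∀ ω : Ω, ∃ x : Coprod G₁ G₂, x • ω₀ = ω := by
    rintro ⟨q₁, q₂⟩
    obtain ⟨a, rfl⟩ := QuotientGroup.mk_surjective q₁
    obtain ⟨b, rfl⟩ := QuotientGroup.mk_surjective q₂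
    refine ⟨(a : Coprod G₁ G₂) * (b : Coprod G₁ G₂), ?_⟩
    rw [mul_smul, hfalse, htrue]
    simp only [ω₀, MulAction.Quotient.smul_coe, smul_eq_mul, mul_one]
  have : MulAction.IsPretransitive (Coprod G₁ G₂) Ω := by
    refine ⟨fun x y => ?_⟩
    obtain ⟨a, rfl⟩ := hsurj x
    obtain ⟨b, rfl⟩ := hsurj y
    exact ⟨b * a⁻¹, by rw [mul_smul, inv_smul_smul]⟩
  let p : ∀ i, Coprod G₁ G₂ → freeFactor G₁ G₂ i ⧸ L i
    | true => fun x => (x⁻¹ • ω₀).1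
    | false => fun x => (x⁻¹ • ω₀).2
  have hp : ∀ q₁ q₂, ∃ x, p true x = q₁ ∧ p false x = q₂ := by
    intro q₁ q₂
    obtain ⟨x, hx⟩ := hsurj (q₁, q₂)
    refine ⟨x⁻¹, ?_, ?_⟩ <;> simp only [p, inv_inv, hx]
  refine ⟨MulAction.stabilizer (Coprod G₁ G₂) ω₀, p, ?_, ?_, ?_, ?_, ?_⟩
  · rw [MulAction.index_stabilizer_of_transitive, Nat.card_prod]
    rfl
  · rintro (_ | _) x a
    · simp only [p, mul_inv_rev, mul_smul]
      rw [← Subgroup.coe_inv, hfalse]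
    · simp only [p, mul_inv_rev, mul_smul]
      rw [← Subgroup.coe_inv, htrue]
  · rintro (_ | _) (_ | _) x a h
    · exact absurd rfl h
    · simp only [p, mul_inv_rev, mul_smul]
      rw [← Subgroup.coe_inv, htrue]
    · simp only [p, mul_inv_rev, mul_smul]
      rw [← Subgroup.coe_inv, hfalse]
    · exact absurd rfl h
  · intro x y
    rw [MulAction.mem_stabilizer_iff, mul_smul, ← eq_inv_smul_iff, Bool.forall_bool, Prod.ext_iff,
      and_comm]
  · rintro (_ | _) q q'
    · obtain ⟨x, h1, h2⟩ := hp q' q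
      exact ⟨x, h2, h1⟩
    · exact hp q q'

theorem exists_subgroup_coprod (L : ∀ i, Subgroup (freeFactor G₁ G₂ i))
    (hL : ∀ i, (L i).index ≠ 0) (S : ∀ i, Set (L i)) (R : ∀ i, Finset (L i × L i))
    (hT : ∀ i, IsTriangulation (S i) (R i)) :
    ∃ H : Subgroup (Coprod G₁ G₂), H.index = (L true).index * (L false).index ∧
      ∃ t ∈ presLengthValues H, t ≤ ∑ i, (L (!i)).index * (R i).card := by
  classical
  obtain ⟨H, p, hindex, hp, hp', hH, hpsurj⟩ := exists_productAction L
  have hLfin : ∀ i, (L i).FiniteIndex := fun i => ⟨hL i⟩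
  have : H.FiniteIndex := ⟨by rw [hindex]; exact mul_ne_zero (hL _) (hL _)⟩
  refine ⟨H, hindex, ?_⟩
  have hpH : ∀ i (k : H) x, p i (k * x) = p i x := fun i k x =>
    ((hH x (k * x)).1 (by simp) i).symm
  -- transversals
  let b : ∀ i, freeFactor G₁ G₂ i ⧸ L i := fun i => ((1 : freeFactor G₁ G₂ i) : _ ⧸ L i)
  let y : ∀ i, freeFactor G₁ G₂ i ⧸ L i → freeFactor G₁ G₂ i := fun i q =>
    if q = b i then 1 else q.out
  have hyb : ∀ i, y i (b i) = 1 := fun i => if_pos rfl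
  have hy : ∀ i q, (y i q)⁻¹ • q = b i := by
    intro i q
    by_cases h : q = b i
    · rw [h, hyb, inv_one, one_smul]
    · simp only [y, h, if_false]
      rw [inv_smul_eq_iff]
      simp only [b, MulAction.Quotient.smul_coe, smul_eq_mul, mul_one]
      exact (QuotientGroup.out_eq' q).symm
  have hpy : ∀ i x, p i (x * y i (p i x)) = b i := fun i x => by rw [hp, hy]
  have hpL : ∀ i x (u : L i), p i x = b i → p i (x * (u : freeFactor G₁ G₂ i)) = b i := by
    intro i x u hx
    rw [hp, hx]
    exact QuotientGroup.eq.2 (by simp)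
  have hpL' : ∀ i x z, x⁻¹ * z ∈ freeFactor G₁ G₂ i → p i x = b i → p i z = b i →
      ∃ u : L i, z = x * (u : freeFactor G₁ G₂ i) := by
    intro i x z ha hx hz
    have h1 := hp i x ⟨_, ha⟩
    rw [mul_inv_cancel_left, hz, hx] at h1
    have h2 := QuotientGroup.eq.1 h1
    refine ⟨⟨⟨_, ha⟩, by simpa using h2⟩, by simp⟩
  -- the complex
  let E : Coprod G₁ G₂ → Coprod G₁ G₂ → Prop := fun x z => ∃ i,
    z = x * y i (p i x) ∨ x = z * y i (p i z) ∨
    (p i x = b i ∧ ∃ s ∈ S i, z = x * (s : freeFactor G₁ G₂ i))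
  let T : Set (Coprod G₁ G₂) := Set.range fun q : Coprod G₁ G₂ ⧸ H => q.out⁻¹
  have hTfin : T.Finite := Set.finite_range _
  have hHT : ∀ x, ∃ k : H, (k : Coprod G₁ G₂) * x ∈ T := by
    intro x
    obtain ⟨k, hk⟩ := QuotientGroup.mk_out_eq_mul H x⁻¹
    exact ⟨k⁻¹, (x⁻¹ : Coprod G₁ G₂), by simp [hk]⟩
  have hE : ∀ (k : H) x z, E x z → E (k * x) (k * z) := by
    rintro k x z ⟨i, rfl | rfl | ⟨hx, s, hs, rfl⟩⟩
    · exact ⟨i, Or.inl (by rw [hpH, mul_assoc])⟩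
    · exact ⟨i, Or.inr (Or.inl (by rw [hpH, mul_assoc]))⟩
    · exact ⟨i, Or.inr (Or.inr ⟨by rw [hpH, hx], s, hs, by rw [mul_assoc]⟩)⟩
  have hEfin : ∀ x, {z | E x z}.Finite := by
    intro x
    refine (((Set.finite_range fun i => x * (y i (p i x) : Coprod G₁ G₂)).union
      (Set.finite_range fun j : Σ i, freeFactor G₁ G₂ i ⧸ L i =>
        x * (y j.1 j.2 : Coprod G₁ G₂)⁻¹)).union
      (Set.finite_iUnion fun i => (hT i).finite.image fun s : L i =>
        x * ((s : freeFactor G₁ G₂ i) : Coprod G₁ G₂))).subset ?_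
    rintro z ⟨i, rfl | h | ⟨hx, s, hs, rfl⟩⟩
    · exact Or.inl (Or.inl ⟨i, rfl⟩)
    · exact Or.inl (Or.inr ⟨⟨i, p i z⟩, mul_inv_eq_iff_eq_mul.2 h⟩)
    · exact Or.inr (Set.mem_iUnion.2 ⟨i, s, hs, rfl⟩)
  have hEsymm : ∀ x z, E x z → E z x := by
    rintro x z ⟨i, h | h | ⟨hx, s, hs, rfl⟩⟩
    · exact ⟨i, Or.inr (Or.inl h)⟩
    · exact ⟨i, Or.inl h⟩
    · exact ⟨i, Or.inr (Or.inr ⟨hpL i x s hx, s⁻¹, (hT i).inv_mem s hs, by simp⟩)⟩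
  choose g hg hg' using fun i q => hpsurj i (b i) q
  let tri : ∀ i, (freeFactor G₁ G₂ (!i) ⧸ L (!i)) × (L i × L i) →
      Coprod G₁ G₂ × Coprod G₁ G₂ × Coprod G₁ G₂ := fun i w =>
    (g i w.1, g i w.1 * (w.2.1 : freeFactor G₁ G₂ i),
      g i w.1 * (w.2.1 : freeFactor G₁ G₂ i) * (w.2.2 : freeFactor G₁ G₂ i))
  have : ∀ i, Fintype (freeFactor G₁ G₂ i ⧸ L i) := fun i => Fintype.ofFinite _
  let RR : Finset (Coprod G₁ G₂ × Coprod G₁ G₂ × Coprod G₁ G₂) :=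
    Finset.univ.biUnion fun i => (Finset.univ ×ˢ R i).image (tri i)
  have hRR : ∀ i q, ∀ r ∈ R i, tri i (q, r) ∈ RR := fun i q r hr =>
    Finset.mem_biUnion.2 ⟨i, Finset.mem_univ _, Finset.mem_image_of_mem _
      (Finset.mem_product.2 ⟨Finset.mem_univ _, hr⟩)⟩
  obtain ⟨t, ht, htR⟩ := exists_presLengthValues_le (MulAction.toPermHom H (Coprod G₁ G₂))
    (fun k x h => by simpa [Subgroup.smul_def] using h) E hE hEsymm 1
    (by
      intro P h1 hP
      refine coprod_induction_right P h1 ?_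
      intro i x a ha hx
      have h2 : P (x * y i (p i x)) := hP _ _ ⟨i, Or.inl rfl⟩ hx
      have h3 : ∀ u : L i, P (x * y i (p i x) * (u : freeFactor G₁ G₂ i)) := by
        refine (hT i).induction _ (by simpa using h2) ?_
        intro u s hs hu
        have h := hP _ _ ⟨i, Or.inr (Or.inr ⟨hpL i _ u (hpy i x), s, hs, rfl⟩)⟩ hu
        simpa [mul_assoc] using h
      obtain ⟨u, hu⟩ := hpL' i (x * y i (p i x)) (x * a * y i (p i (x * a)))
        (by
          have : (x * y i (p i x) : Coprod G₁ G₂)⁻¹ * (x * a * y i (p i (x * a))) =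
            (y i (p i x) : Coprod G₁ G₂)⁻¹ * a * y i (p i (x * a)) := by group
          rw [this]
          exact mul_mem (mul_mem (inv_mem (SetLike.coe_mem _)) ha) (SetLike.coe_mem _))
        (hpy i x) (hpy i _)
      exact hP _ _ ⟨i, Or.inr (Or.inl rfl)⟩ (hu ▸ h3 u))
    {w | w.1 ∈ T ∧ E w.1 w.2}
    ((hTfin.biUnion fun x _ => (hEfin x).image (Prod.mk x)).subset (by
      rintro ⟨x, z⟩ ⟨hx, hxz⟩
      exact Set.mem_biUnion hx ⟨z, hxz, rfl⟩))
    (by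
      intro x z hxz
      obtain ⟨k, hk⟩ := hHT x
      exact ⟨k, hk, hE k x z hxz⟩)
    RR
    (by
      intro t ht
      obtain ⟨i, -, ht⟩ := Finset.mem_biUnion.1 ht
      obtain ⟨⟨q, r⟩, hr, rfl⟩ := Finset.mem_image.1 ht
      obtain ⟨h1, h2, h3⟩ := (hT i).mem r (Finset.mem_product.1 hr).2
      refine ⟨⟨i, Or.inr (Or.inr ⟨hg i q, r.1, h1, rfl⟩)⟩,
        ⟨i, Or.inr (Or.inr ⟨hpL i _ _ (hg i q), r.2, h2, rfl⟩)⟩,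
        ⟨i, Or.inr (Or.inr ⟨hpL i _ _ (hpL i _ _ (hg i q)), _, (hT i).inv_mem _ h3, ?_⟩)⟩⟩
      simp [tri, mul_assoc])
    (by
      intro Q _ c hc hcR
      -- potentials on the cosets of the factors
      have hη : ∀ i x, ∃ η : L i → Q, p i x = b i → ∀ u : L i, ∀ s ∈ S i,
          c (x * (u : freeFactor G₁ G₂ i))
            (x * (u : freeFactor G₁ G₂ i) * (s : freeFactor G₁ G₂ i)) =
            (η u)⁻¹ * η (u * s) := by
        intro i x
        by_cases hx : p i x = b i
        swap
        · exact ⟨fun _ => 1, fun h => absurd h hx⟩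
        obtain ⟨η, hη⟩ := (hT i).exists_potential Q
          (fun u v => c (x * (u : freeFactor G₁ G₂ i)) (x * (v : freeFactor G₁ G₂ i)))
          ⟨fun _ => hc.diag _, fun _ _ => hc.mul_swap _ _⟩
          (by
            intro u r hr
            let z := x * ((u : freeFactor G₁ G₂ i) : Coprod G₁ G₂)
            have hz : z * (g i (p (!i) z))⁻¹ ∈ H := by
              rw [hH]
              intro j
              rcases Bool.eq_or_eq_not j i with rfl | rfl
              · rw [hg]
                exact (hpL _ x u hx).symm
              · rw [hg']
            have := hcR ⟨_, hz⟩ _ (hRR i (p (!i) z) r hr)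
            simpa [tri, Subgroup.smul_def, z, boundaryProd, mul_assoc] using this)
        refine ⟨η, fun _ u s hs => ?_⟩
        have := hη u s hs
        simpa [mul_assoc] using this
      choose η hη using hη
      let rep : ∀ i, Coprod G₁ G₂ → Coprod G₁ G₂ := fun i x =>
        (x : Coprod G₁ G₂ ⧸ freeFactor G₁ G₂ i).out *
          y i (p i (x : Coprod G₁ G₂ ⧸ freeFactor G₁ G₂ i).out)
      have hrepb : ∀ i x, p i (rep i x) = b i := fun i x => hpy i _
      have hrepa : ∀ i x, ∀ a ∈ freeFactor G₁ G₂ i, rep i (x * a) = rep i x := by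
        intro i x a ha
        have : ((x * a : Coprod G₁ G₂) : Coprod G₁ G₂ ⧸ freeFactor G₁ G₂ i) = x :=
          (QuotientGroup.mk_mul_of_mem x ha)
        simp only [rep, this]
      have hrepm : ∀ i x, (rep i x)⁻¹ * x ∈ freeFactor G₁ G₂ i := by
        intro i x
        obtain ⟨a, ha⟩ := QuotientGroup.mk_out_eq_mul (freeFactor G₁ G₂ i) x
        simp only [rep]
        rw [← Subgroup.inv_mem_iff, mul_inv_rev, inv_inv, ← mul_assoc]
        refine mul_mem ?_ (SetLike.coe_mem _)
        rw [ha, inv_mul_cancel_left]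
        exact SetLike.coe_mem _
      have hu : ∀ i x, ∃ u : L i, x * y i (p i x) = rep i x * (u : freeFactor G₁ G₂ i) := by
        intro i x
        refine hpL' i _ _ ?_ (hrepb i x) (hpy i x)
        rw [← mul_assoc]
        exact mul_mem (hrepm i x) (SetLike.coe_mem _)
      choose u hu using hu
      let h : ∀ _ : Bool, Coprod G₁ G₂ → Q := fun i x =>
        η i (rep i x) (u i x) * (c x (x * y i (p i x)))⁻¹
      have hbase : ∀ i x, p i x = b i → h i x = η i (rep i x) (u i x) := by
        intro i x hx
        simp only [h, hx, hyb, Subgroup.coe_one, mul_one, hc.diag, inv_one]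
      have hhair : ∀ i x, c x (x * y i (p i x)) = (h i x)⁻¹ * h i (x * y i (p i x)) := by
        intro i x
        have h1 : rep i (x * y i (p i x)) = rep i x := hrepa i x _ (SetLike.coe_mem _)
        have h2 : u i (x * y i (p i x)) = u i x := by
          have h3 := hu i (x * y i (p i x))
          rw [hpy, hyb, h1, Subgroup.coe_one, mul_one] at h3
          exact (Subtype.ext (Subtype.ext (mul_left_cancel ((hu i x).symm.trans h3)))).symm
        rw [hbase i _ (hpy i x), h1, h2]
        simp only [h]
        group
      have hcay : ∀ i x, p i x = b i → ∀ s ∈ S i, c x (x * (s : freeFactor G₁ G₂ i)) =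
          (h i x)⁻¹ * h i (x * (s : freeFactor G₁ G₂ i)) := by
        intro i x hx s hs
        have h1 : rep i (x * (s : freeFactor G₁ G₂ i)) = rep i x := hrepa i x _ (SetLike.coe_mem _)
        have h0 : x = rep i x * (u i x : freeFactor G₁ G₂ i) := by
          have := hu i x
          rwa [hx, hyb, Subgroup.coe_one, mul_one] at this
        have h2 : u i (x * (s : freeFactor G₁ G₂ i)) = u i x * s := by
          have h3 := hu i (x * (s : freeFactor G₁ G₂ i))
          rw [hpL i x s hx, hyb, h1, Subgroup.coe_one, mul_one] at h3
          have h4 := (congrArg (· * ((s : freeFactor G₁ G₂ i) : Coprod G₁ G₂)) h0.symm).trans h3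
          rw [mul_assoc] at h4
          have h5 := mul_left_cancel h4
          exact Subtype.ext (Subtype.ext h5.symm)
        have h6 := hη i _ (hrepb i x) (u i x) s hs
        rw [← h0] at h6
        rw [hbase i x hx, hbase i _ (hpL i x s hx), h1, h2, h6]
      obtain ⟨f, -, hf⟩ := coprod_exists_potential (fun i x z => (h i x)⁻¹ * h i z) (by
        intros
        group)
      have hf' : ∀ i x, ∀ a ∈ freeFactor G₁ G₂ i,
          (f x)⁻¹ * f (x * a) = (h i x)⁻¹ * h i (x * a) := by
        intro i x a ha
        rw [hf i x a ha, inv_mul_cancel_left]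
      refine ⟨f, ?_⟩
      rintro x z ⟨i, rfl | h' | ⟨hx, s, hs, rfl⟩⟩
      · rw [hf' i x _ (SetLike.coe_mem _), hhair]
      · have h1 := hhair i z
        rw [← hf' i z _ (SetLike.coe_mem _), ← h'] at h1
        rw [hc.swap, h1]
        group
      · rw [hf' i x _ (SetLike.coe_mem _), hcay i x hx s hs])
  refine ⟨t, ht, htR.trans ?_⟩
  refine Finset.card_biUnion_le.trans (Finset.sum_le_sum fun i _ => Finset.card_image_le.trans ?_)
  rw [Finset.card_product, Finset.card_univ, Subgroup.index, Nat.card_eq_fintype_card]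

end Coprod

/-- Collapsing the edges of a triangulation that are not separated by an equivariant map to a free
`K`-set produces a simply connected complex on which `K` acts. -/
theorem IsTriangulation.exists_presLengthValues_le {Γ K Y : Type*} [Group Γ] [Group K]
    [MulAction K Y] (hfree : ∀ (k : K) (y : Y), k • y = y → k = 1) {S : Set Γ} {R : Finset (Γ × Γ)}
    (hT : IsTriangulation S R) (θ : K →* Γ) (f : Γ → Y) (hf : ∀ k x, f (θ k * x) = k • f x)
    (D : Set Γ) (hD : D.Finite)
    (hSD : ∀ x, ∀ s ∈ S, f x ≠ f (x * s) → ∃ k, θ k * x ∈ D) (R' : Finset (Γ × Γ))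
    (hR' : ∀ r, r ∈ R' ↔ r ∈ R ∧ ∃ x, f x ≠ f (x * r.1) ∧ f (x * r.1) ≠ f (x * r.1 * r.2) ∧
      f (x * r.1 * r.2) ≠ f x)
    (huniq : ∀ r ∈ R, ∀ x y,
      (f x ≠ f (x * r.1) ∧ f (x * r.1) ≠ f (x * r.1 * r.2) ∧ f (x * r.1 * r.2) ≠ f x) →
      (f y ≠ f (y * r.1) ∧ f (y * r.1) ≠ f (y * r.1 * r.2) ∧ f (y * r.1 * r.2) ≠ f y) →
      ∃ k, θ k * x = y) :
    ∃ t ∈ presLengthValues K, t ≤ R'.card := by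
  classical
  let rel : Γ → Γ → Prop := fun x y => ∃ s ∈ S, y = x * s ∧ f x = f y
  let X := Quot rel
  let mk : Γ → X := Quot.mk rel
  have hmk : ∀ x, ∀ s ∈ S, f x = f (x * s) → mk x = mk (x * s) := fun x s hs h =>
    Quot.sound ⟨s, hs, rfl, h⟩
  let _ : MulAction K X :=
    { smul := fun k => Quot.map (fun x => θ k * x) (by
        rintro x _ ⟨s, hs, rfl, h⟩
        exact ⟨s, hs, (mul_assoc _ _ _).symm, by rw [hf, hf, h]⟩)
      one_smul := by
        rintro ⟨x⟩
        change mk (θ 1 * x) = mk x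
        rw [map_one, one_mul]
      mul_smul := by
        rintro k l ⟨x⟩
        change mk (θ (k * l) * x) = mk (θ k * (θ l * x))
        rw [map_mul, mul_assoc] }
  have hsmul : ∀ (k : K) x, k • mk x = mk (θ k * x) := fun _ _ => rfl
  let F : X → Y := Quot.lift f fun _ _ ⟨_, _, _, h⟩ => h
  let E : X → X → Prop := fun p q => ∃ x, ∃ s ∈ S, f x ≠ f (x * s) ∧ p = mk x ∧ q = mk (x * s)
  have hsel : ∀ r, ∃ x, r ∈ R' → f x ≠ f (x * r.1) ∧ f (x * r.1) ≠ f (x * r.1 * r.2) ∧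
      f (x * r.1 * r.2) ≠ f x := by
    intro r
    by_cases h : r ∈ R'
    · obtain ⟨x, hx⟩ := ((hR' r).1 h).2
      exact ⟨x, fun _ => hx⟩
    · exact ⟨1, fun h' => absurd h' h⟩
  choose b hb using hsel
  let tri : Γ × Γ → X × X × X := fun r => (mk (b r), mk (b r * r.1), mk (b r * r.1 * r.2))
  obtain ⟨t, ht, htR⟩ := _root_.exists_presLengthValues_le (MulAction.toPermHom K X)
    (by
      rintro k ⟨x⟩ h
      refine hfree k (f x) ?_
      rw [← hf]
      exact congrArg F h)
    E
    (by
      rintro k _ _ ⟨x, s, hs, h, rfl, rfl⟩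
      refine ⟨θ k * x, s, hs, ?_, rfl, ?_⟩
      · rw [mul_assoc, hf, hf]
        exact fun h' => h (MulAction.injective k h')
      · rw [mul_assoc]
        rfl)
    (by
      rintro _ _ ⟨x, s, hs, h, rfl, rfl⟩
      refine ⟨x * s, s⁻¹, hT.inv_mem s hs, ?_, rfl, ?_⟩
      · rw [mul_inv_cancel_right]
        exact h.symm
      · rw [mul_inv_cancel_right])
    (mk 1)
    (by
      rintro P h1 hP ⟨x⟩
      refine hT.induction (fun x => P (mk x)) h1 ?_ x
      intro x s hs hx
      by_cases h : f x = f (x * s)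
      · rwa [hmk x s hs h] at hx
      · exact hP _ _ ⟨x, s, hs, h, rfl, rfl⟩ hx)
    ((fun p : Γ × Γ => (mk p.1, mk (p.1 * p.2))) '' D ×ˢ S)
    ((hD.prod hT.finite).image _)
    (by
      rintro _ _ ⟨x, s, hs, h, rfl, rfl⟩
      obtain ⟨k, hk⟩ := hSD x s hs h
      exact ⟨k, (θ k * x, s), ⟨hk, hs⟩, Prod.ext rfl (congrArg mk (mul_assoc _ _ _))⟩)
    (R'.image tri)
    (by
      intro t ht
      obtain ⟨r, hr, rfl⟩ := Finset.mem_image.1 ht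
      obtain ⟨h1, h2, h3⟩ := hT.mem r ((hR' r).1 hr).1
      obtain ⟨h4, h5, h6⟩ := hb r hr
      refine ⟨⟨_, _, h1, h4, rfl, rfl⟩, ⟨_, _, h2, h5, rfl, rfl⟩,
        ⟨b r * r.1 * r.2, _, hT.inv_mem _ h3, ?_, rfl, ?_⟩⟩
      · rwa [mul_assoc (b r), mul_inv_cancel_right, ← mul_assoc]
      · rw [mul_assoc (b r), mul_inv_cancel_right])
    (by
      intro Q _ c hc hcR
      obtain ⟨h, hh⟩ := hT.exists_potential Q (fun x y => c (mk x) (mk y))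
        ⟨fun _ => hc.diag _, fun _ _ => hc.mul_swap _ _⟩ (by
          intro x r hr
          obtain ⟨h1, h2, h3⟩ := hT.mem r hr
          by_cases e1 : f x = f (x * r.1)
          · simp only [boundaryProd, hmk x _ h1 e1, hc.diag, one_mul, hc.mul_swap]
          by_cases e2 : f (x * r.1) = f (x * r.1 * r.2)
          · simp only [boundaryProd, hmk _ _ h2 e2, hc.diag, mul_one, hc.mul_swap]
          by_cases e3 : f (x * r.1 * r.2) = f x
          · have : mk x = mk (x * r.1 * r.2) := by
              rw [mul_assoc] at e3 ⊢
              exact hmk x _ h3 e3.symm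
            simp only [boundaryProd, ← this, hc.diag, mul_one, hc.mul_swap]
          have hr' : r ∈ R' := (hR' r).2 ⟨hr, x, e1, e2, e3⟩
          obtain ⟨k, hk⟩ := huniq r hr (b r) x (hb r hr') ⟨e1, e2, e3⟩
          change boundaryProd c (mk x) (mk (x * r.1)) (mk (x * r.1 * r.2)) = 1
          have := hcR k _ (Finset.mem_image_of_mem tri hr')
          simpa only [MulAction.toPermHom_apply, MulAction.toPerm_apply, tri, hsmul, ← mul_assoc,
            hk] using this)
      refine ⟨Quot.lift h ?_, ?_⟩
      · rintro x _ ⟨s, hs, rfl, e⟩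
        have := hh x s hs
        simp only [← hmk x s hs e, hc.diag] at this
        exact (inv_mul_eq_one.1 this.symm)
      · rintro _ _ ⟨x, s, hs, -, rfl, rfl⟩
        exact hh x s hs)
  exact ⟨t, ht, htR.trans Finset.card_image_le⟩

section Coprod

variable {G₁ G₂ : Type*} [Group G₁] [Group G₂] {π : Bool → Coprod G₁ G₂ → Coprod G₁ G₂}

theorem finite_setOf_projection_ne
    (hπ : ∀ i j x, ∀ b ∈ freeFactor G₁ G₂ j, π i (x * b) ≠ π i x →
      i = j ∧ x ∈ freeFactor G₁ G₂ i) (i : Bool) (s : Coprod G₁ G₂) :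
    {q : Coprod G₁ G₂ ⧸ freeFactor G₁ G₂ i |
      ∃ y : Coprod G₁ G₂, q = y ∧ π i y⁻¹ ≠ π i (y⁻¹ * s)}.Finite := by
  refine coprod_induction_right (fun s => {q : Coprod G₁ G₂ ⧸ freeFactor G₁ G₂ i |
    ∃ y : Coprod G₁ G₂, q = y ∧ π i y⁻¹ ≠ π i (y⁻¹ * s)}.Finite) (by simp) ?_ s
  intro j x a ha hx
  refine (hx.insert (x : Coprod G₁ G₂ ⧸ freeFactor G₁ G₂ i)).subset ?_
  rintro _ ⟨y, rfl, hy⟩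
  by_cases h : π i y⁻¹ = π i (y⁻¹ * x)
  · rw [h, ← mul_assoc] at hy
    exact Or.inl (QuotientGroup.eq.2 (hπ i j _ a ha hy.symm).2)
  · exact Or.inr ⟨y, rfl, h⟩

theorem projection_eq_or_projection_eq
    (hπ : ∀ i j x, ∀ b ∈ freeFactor G₁ G₂ j, π i (x * b) ≠ π i x →
      i = j ∧ x ∈ freeFactor G₁ G₂ i) {i j : Bool} {g g' : Coprod G₁ G₂}
    (h : ¬ (i = j ∧ g⁻¹ * g' ∈ freeFactor G₁ G₂ i)) (x : Coprod G₁ G₂) :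
    π i (g⁻¹ * x) = π i (g⁻¹ * g') ∨ π j (g'⁻¹ * x) = π j (g'⁻¹ * g) := by
  have h1 : ∀ b ∈ freeFactor G₁ G₂ j, π i (g⁻¹ * g' * b) = π i (g⁻¹ * g') := by
    intro b hb
    by_contra hne
    exact h (hπ i j _ b hb hne)
  have h2 : ∀ b ∈ freeFactor G₁ G₂ i, π j (g'⁻¹ * g * b) = π j (g'⁻¹ * g) := by
    intro b hb
    by_contra hne
    obtain ⟨rfl, h3⟩ := hπ j i _ b hb hne
    exact h ⟨rfl, by simpa using inv_mem h3⟩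
  have key : ∀ z, π i (g⁻¹ * (g' * z)) = π i (g⁻¹ * g') ∨
      π j (g'⁻¹ * (g' * z)) = π j (g'⁻¹ * g) := by
    refine coprod_induction_right _ (by simp) ?_
    intro k z a ha hz
    rcases hz with hz | hz
    · by_cases hne : π i (g⁻¹ * (g' * z) * a) = π i (g⁻¹ * (g' * z))
      · left
        rw [← hz, ← hne]
        simp only [mul_assoc]
      · obtain ⟨rfl, h3⟩ := hπ i k _ a ha hne
        right
        rw [← h2 _ (mul_mem h3 ha)]
        congr 1
        group
    · by_cases hne : π j (g'⁻¹ * (g' * z) * a) = π j (g'⁻¹ * (g' * z))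
      · right
        rw [← hz, ← hne]
        simp only [mul_assoc]
      · obtain ⟨rfl, h3⟩ := hπ j k _ a ha hne
        left
        rw [← h1 _ (mul_mem h3 ha)]
        congr 1
        group
  simpa using key (g'⁻¹ * x)

/-- The three edges `x`, `y`, `z` of the Bass–Serre tree have distinct projections at the vertex
`g (freeFactor i)`, which is then the centre of the tripod they span. -/
def IsCentre (π : Bool → Coprod G₁ G₂ → Coprod G₁ G₂) (i : Bool) (g x y z : Coprod G₁ G₂) : Prop :=
  π i (g⁻¹ * x) ≠ π i (g⁻¹ * y) ∧ π i (g⁻¹ * y) ≠ π i (g⁻¹ * z) ∧ π i (g⁻¹ * z) ≠ π i (g⁻¹ * x)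

theorem IsCentre.unique
    (hπ : ∀ i j x, ∀ b ∈ freeFactor G₁ G₂ j, π i (x * b) ≠ π i x →
      i = j ∧ x ∈ freeFactor G₁ G₂ i) {i j : Bool} {g g' x y z : Coprod G₁ G₂}
    (h : IsCentre π i g x y z) (h' : IsCentre π j g' x y z) :
    i = j ∧ g⁻¹ * g' ∈ freeFactor G₁ G₂ i := by
  by_contra hne
  obtain ⟨h1, h2, h3⟩ := h
  obtain ⟨h4, h5, h6⟩ := h'
  have hx := projection_eq_or_projection_eq hπ hne x
  have hy := projection_eq_or_projection_eq hπ hne y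
  have hz := projection_eq_or_projection_eq hπ hne z
  grind

theorem IsCentre.translate {i : Bool} {g x y z : Coprod G₁ G₂} (h : IsCentre π i g x y z)
    (w : Coprod G₁ G₂) : IsCentre π i (w * g) (w * x) (w * y) (w * z) := by
  have : ∀ v, (w * g)⁻¹ * (w * v) = g⁻¹ * v := fun v => by group
  simpa only [IsCentre, this] using h

theorem IsCentre.unique_of_subgroup
    (hπ : ∀ i j x, ∀ b ∈ freeFactor G₁ G₂ j, π i (x * b) ≠ π i x →
      i = j ∧ x ∈ freeFactor G₁ G₂ i) {i j : Bool} {g g' : Coprod G₁ G₂}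
    {H : Subgroup (Coprod G₁ G₂)} {x y a b : H}
    (h : IsCentre π i g x (x * a : H) (x * a * b : H))
    (h' : IsCentre π j g' y (y * a : H) (y * a * b : H)) :
    i = j ∧ g⁻¹ * (x * (y : Coprod G₁ G₂)⁻¹ * g') ∈ freeFactor G₁ G₂ i := by
  have h1 := h'.translate (x * (y : Coprod G₁ G₂)⁻¹)
  simp only [Subgroup.coe_mul, ← mul_assoc, inv_mul_cancel_right] at h h1 ⊢
  simpa only [← mul_assoc] using h.unique hπ h1

theorem exists_presLengthValues_stabilizer_le
    (hπ' : ∀ i, ∀ a ∈ freeFactor G₁ G₂ i, ∀ x, π i (a * x) = a * π i x)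
    (hπ : ∀ i j x, ∀ b ∈ freeFactor G₁ G₂ j, π i (x * b) ≠ π i x →
      i = j ∧ x ∈ freeFactor G₁ G₂ i) {H : Subgroup (Coprod G₁ G₂)} {S : Set H}
    {R : Finset (H × H)} (hT : IsTriangulation S R) (i : Bool) (g : Coprod G₁ G₂)
    (R' : Finset (H × H))
    (hR' : ∀ r, r ∈ R' ↔ r ∈ R ∧ ∃ x : H, IsCentre π i g x (x * r.1 : H) (x * r.1 * r.2 : H)) :
    ∃ t ∈ presLengthValues (MulAction.stabilizer (freeFactor G₁ G₂ i)
      ((g⁻¹ : Coprod G₁ G₂) : Coprod G₁ G₂ ⧸ H)), t ≤ R'.card := by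
  let K := MulAction.stabilizer (freeFactor G₁ G₂ i) ((g⁻¹ : Coprod G₁ G₂) : Coprod G₁ G₂ ⧸ H)
  have hK : ∀ a : freeFactor G₁ G₂ i, a ∈ K ↔ g * a * g⁻¹ ∈ H := by
    intro a
    rw [MulAction.mem_stabilizer_iff, eq_comm]
    refine QuotientGroup.eq.trans ?_
    rw [inv_inv]
    change g * (a * g⁻¹) ∈ H ↔ _
    rw [← mul_assoc]
  let θ : K →* H :=
    { toFun := fun k => ⟨g * (k : freeFactor G₁ G₂ i) * g⁻¹, (hK _).1 k.2⟩
      map_one' := by ext; simp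
      map_mul' := fun k l => by ext; simp [mul_assoc] }
  have hθ : ∀ k, (θ k : Coprod G₁ G₂) = g * (k : freeFactor G₁ G₂ i) * g⁻¹ := fun _ => rfl
  have htrans : ∀ x y : H, g⁻¹ * (y * (x : Coprod G₁ G₂)⁻¹ * g) ∈ freeFactor G₁ G₂ i →
      ∃ k, θ k * x = y := by
    intro x y h
    refine ⟨⟨⟨_, h⟩, (hK _).2 ?_⟩, Subtype.ext ?_⟩
    · have : g * (g⁻¹ * (y * (x : Coprod G₁ G₂)⁻¹ * g)) * g⁻¹ = y * (x : Coprod G₁ G₂)⁻¹ := by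
        group
      rw [this]
      exact mul_mem y.2 (inv_mem x.2)
    · rw [Subgroup.coe_mul, hθ]
      simp only
      group
  let m : H → Coprod G₁ G₂ ⧸ freeFactor G₁ G₂ i := fun x => ((x⁻¹ * g : Coprod G₁ G₂) : _)
  let B : Set (Coprod G₁ G₂ ⧸ freeFactor G₁ G₂ i) := ⋃ s ∈ S,
    {q | ∃ y : Coprod G₁ G₂, q = y ∧ π i y⁻¹ ≠ π i (y⁻¹ * (s : H))}
  have hB : B.Finite := hT.finite.biUnion fun s _ => finite_setOf_projection_ne hπ i s
  refine hT.exists_presLengthValues_le (K := K) (Y := Coprod G₁ G₂)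
    (fun k y h => Subtype.ext (Subtype.ext (mul_eq_right.1 h))) θ (fun x => π i (g⁻¹ * x)) ?_
    (Function.invFun m '' B) (hB.image _) ?_ R' hR' ?_
  · intro k x
    refine Eq.trans ?_ (hπ' i _ (k : freeFactor G₁ G₂ i).2 _)
    rw [Subgroup.coe_mul, hθ]
    congr 1
    group
  · intro x s hs hne
    have hm : m x ∈ B := by
      refine Set.mem_biUnion hs ⟨_, rfl, ?_⟩
      simpa [mul_assoc] using hne
    obtain ⟨k, hk⟩ := htrans x (Function.invFun m (m x)) (by
      have h1 : m (Function.invFun m (m x)) = m x := Function.invFun_eq ⟨x, rfl⟩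
      have h2 := QuotientGroup.eq.1 h1
      simpa [mul_assoc] using h2)
    exact ⟨k, hk ▸ Set.mem_image_of_mem _ hm⟩
  · intro r _ x y hx hy
    refine htrans x y ?_
    have hx' : IsCentre π i g x (x * r.1 : H) (x * r.1 * r.2 : H) := hx
    have hy' : IsCentre π i g y (y * r.1 : H) (y * r.1 * r.2 : H) := hy
    exact (hy'.unique_of_subgroup hπ hx').2

end Coprod

theorem stablePresLength_le {G : Type*} [Group G] {H : Subgroup G} (hH : H.index ≠ 0) :
    stablePresLength G ≤ presLength H / H.index := by
  refine csInf_le ⟨0, ?_⟩ ⟨H, hH, rfl⟩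
  rintro _ ⟨H, -, rfl⟩
  positivity

theorem le_stablePresLength {G : Type*} [Group G] {c : ℝ}
    (h : ∀ H : Subgroup G, H.index ≠ 0 → c ≤ presLength H / H.index) : c ≤ stablePresLength G := by
  refine le_csInf ⟨_, ⊤, by simp, rfl⟩ ?_
  rintro _ ⟨H, hH, rfl⟩
  exact h H hH

theorem presLength_congr {G G' : Type*} [Group G] [Group G'] (e : G ≃* G') :
    presLength G = presLength G' := by
  rw [presLength, presLength, presLengthValues_congr e]

theorem stablePresLength_le_of_mulEquiv {G G' : Type*} [Group G] [Group G'] (e : G ≃* G') :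
    stablePresLength G ≤ stablePresLength G' := by
  refine le_stablePresLength fun H hH => ?_
  have hindex : (H.map e.symm.toMonoidHom).index = H.index := Subgroup.index_map_equiv H e.symm
  rw [presLength_congr (e.symm.subgroupMap H), ← hindex]
  exact stablePresLength_le (hindex ▸ hH)

theorem stablePresLength_congr {G G' : Type*} [Group G] [Group G'] (e : G ≃* G') :
    stablePresLength G = stablePresLength G' :=
  (stablePresLength_le_of_mulEquiv e).antisymm (stablePresLength_le_of_mulEquiv e.symm)

theorem FinitelyPresentable.subgroup {G : Type*} [Group G] (hG : FinitelyPresentable G)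
    (H : Subgroup G) (hH : H.index ≠ 0) : FinitelyPresentable H := by
  obtain ⟨t, ht⟩ := hG
  obtain ⟨S, R, hT, -⟩ := exists_isTriangulation ht
  exact hT.nonempty_presLengthValues H hH

theorem FinitelyPresentable.exists_isTriangulation {G : Type*} [Group G]
    (hG : FinitelyPresentable G) :
    ∃ (S : Set G) (R : Finset (G × G)), IsTriangulation S R ∧ R.card ≤ presLength G :=
  _root_.exists_isTriangulation (Nat.sInf_mem hG)

theorem sum_index_stabilizer_out {A X : Type*} [Group A] [MulAction A X] [Finite X]
    [Fintype (MulAction.orbitRel.Quotient A X)] :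
    ∑ ω : MulAction.orbitRel.Quotient A X, (MulAction.stabilizer A (Quotient.out ω)).index =
      Nat.card X := by
  rw [Nat.card_congr (MulAction.selfEquivSigmaOrbitsQuotientStabilizer A X)]
  have : ∀ ω : MulAction.orbitRel.Quotient A X,
      Finite (A ⧸ MulAction.stabilizer A (Quotient.out ω)) := fun ω =>
    Finite.of_equiv _ (MulAction.orbitEquivQuotientStabilizer A (Quotient.out ω))
  rw [Nat.card_sigma]
  rfl

section Coprod

variable {G₁ G₂ : Type*} [Group G₁] [Group G₂]

theorem index_mul_sum_stablePresLength_le {H : Subgroup (Coprod G₁ G₂)} (hH : H.index ≠ 0)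
    (hHfp : FinitelyPresentable H) :
    (H.index : ℝ) * ∑ i, stablePresLength (freeFactor G₁ G₂ i) ≤ presLength H := by
  classical
  obtain ⟨π, hπ', hπ⟩ := exists_projection (G₁ := G₁) (G₂ := G₂)
  obtain ⟨S, R, hT, hR⟩ := hHfp.exists_isTriangulation
  have : H.FiniteIndex := ⟨hH⟩
  let Ω : Bool → Type _ := fun i =>
    MulAction.orbitRel.Quotient (freeFactor G₁ G₂ i) (Coprod G₁ G₂ ⧸ H)
  have : ∀ i, Fintype (Ω i) := fun i => Fintype.ofFinite _
  have hg : ∀ w : Σ i, Ω i, ∃ g : Coprod G₁ G₂,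
      ((g⁻¹ : Coprod G₁ G₂) : Coprod G₁ G₂ ⧸ H) = Quotient.out w.2 := by
    intro w
    obtain ⟨g, hg⟩ := QuotientGroup.mk_surjective (Quotient.out w.2)
    exact ⟨g⁻¹, by rw [inv_inv, hg]⟩
  choose g hg using hg
  let R' : (Σ i, Ω i) → Finset (H × H) := fun w => R.filter fun r =>
    ∃ x : H, IsCentre π w.1 (g w) x (x * r.1 : H) (x * r.1 * r.2 : H)
  have hdisj : ∀ v w r, r ∈ R' v → r ∈ R' w → v = w := by
    intro v w r hv hw
    obtain ⟨x, hx⟩ := (Finset.mem_filter.1 hv).2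
    obtain ⟨y, hy⟩ := (Finset.mem_filter.1 hw).2
    obtain ⟨hvw, ha⟩ := hx.unique_of_subgroup hπ hy
    have hgv := hg v
    have hgw := hg w
    obtain ⟨i, v⟩ := v
    obtain ⟨j, w⟩ := w
    obtain rfl : i = j := hvw
    congr 1
    rw [← Quotient.out_eq v, ← Quotient.out_eq w]
    refine Quotient.sound ⟨⟨_, ha⟩, ?_⟩
    simp only at hgv hgw ⊢
    rw [← hgv, ← hgw]
    refine QuotientGroup.eq.2 ?_
    change ((g ⟨i, v⟩)⁻¹ * (x * (y : Coprod G₁ G₂)⁻¹ * g ⟨i, w⟩) * (g ⟨i, w⟩)⁻¹)⁻¹ *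
      (g ⟨i, v⟩)⁻¹ ∈ H
    have : ((g ⟨i, v⟩)⁻¹ * (x * (y : Coprod G₁ G₂)⁻¹ * g ⟨i, w⟩) * (g ⟨i, w⟩)⁻¹)⁻¹ *
        (g ⟨i, v⟩)⁻¹ = y * (x : Coprod G₁ G₂)⁻¹ := by
      group
    rw [this]
    exact mul_mem y.2 (inv_mem x.2)
  have hcard : ∑ w, (R' w).card ≤ presLength H := by
    rw [← Finset.card_biUnion fun v _ w _ hvw =>
      Finset.disjoint_left.2 fun r hv hw => hvw (hdisj v w r hv hw)]
    refine (Finset.card_le_card (Finset.biUnion_subset.2 fun _ _ => ?_)).trans hR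
    exact Finset.filter_subset _ _
  have hstab : ∀ w : Σ i, Ω i,
      ((MulAction.stabilizer (freeFactor G₁ G₂ w.1) (Quotient.out w.2)).index : ℝ) *
        stablePresLength (freeFactor G₁ G₂ w.1) ≤ (R' w).card := by
    intro w
    have hindex : (MulAction.stabilizer (freeFactor G₁ G₂ w.1) (Quotient.out w.2)).index ≠ 0 := by
      have := Finite.of_equiv _
        (MulAction.orbitEquivQuotientStabilizer (freeFactor G₁ G₂ w.1) (Quotient.out w.2))
      exact Nat.card_pos.ne'
    obtain ⟨t, ht, htR⟩ := exists_presLengthValues_stabilizer_le hπ' hπ hT w.1 (g w) (R' w)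
      fun r => Finset.mem_filter
    rw [hg w] at ht
    have h1 := stablePresLength_le hindex
    rw [le_div_iff₀' (by positivity)] at h1
    exact h1.trans (by exact_mod_cast (Nat.sInf_le ht).trans htR)
  calc (H.index : ℝ) * ∑ i, stablePresLength (freeFactor G₁ G₂ i)
      = ∑ w : Σ i, Ω i,
          ((MulAction.stabilizer (freeFactor G₁ G₂ w.1) (Quotient.out w.2)).index : ℝ) *
            stablePresLength (freeFactor G₁ G₂ w.1) := by
        rw [Fintype.sum_sigma, Finset.mul_sum]
        refine Finset.sum_congr rfl fun i _ => ?_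
        change _ = ∑ y : Ω i,
          ((MulAction.stabilizer (freeFactor G₁ G₂ i) (Quotient.out y)).index : ℝ) *
            stablePresLength (freeFactor G₁ G₂ i)
        rw [← Finset.sum_mul, ← Nat.cast_sum]
        congr 2
        exact sum_index_stabilizer_out.symm
    _ ≤ ∑ w, ((R' w).card : ℝ) := Finset.sum_le_sum fun w _ => hstab w
    _ ≤ presLength H := by exact_mod_cast hcard

theorem FinitelyPresentable.coprod (h : ∀ i, FinitelyPresentable (freeFactor G₁ G₂ i)) :
    FinitelyPresentable (Coprod G₁ G₂) := by
  have hfp : ∀ i, FinitelyPresentable (⊤ : Subgroup (freeFactor G₁ G₂ i)) := fun i =>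
    (h i).subgroup ⊤ (by simp)
  choose S R hT _ using fun i => (hfp i).exists_isTriangulation
  obtain ⟨H, hH, t, ht, -⟩ := exists_subgroup_coprod
    (fun i => (⊤ : Subgroup (freeFactor G₁ G₂ i))) (fun i => by simp) S R hT
  simp only [Subgroup.index_top, mul_one, Subgroup.index_eq_one] at hH
  subst hH
  rw [presLengthValues_congr Subgroup.topEquiv] at ht
  exact ⟨t, ht⟩

theorem stablePresLength_coprod_le (h : ∀ i, FinitelyPresentable (freeFactor G₁ G₂ i))
    (L : ∀ i, Subgroup (freeFactor G₁ G₂ i)) (hL : ∀ i, (L i).index ≠ 0) :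
    stablePresLength (Coprod G₁ G₂) ≤
      presLength (L true) / (L true).index + presLength (L false) / (L false).index := by
  choose S R hT hR using fun i => ((h i).subgroup (L i) (hL i)).exists_isTriangulation
  obtain ⟨H, hH, t, ht, htR⟩ := exists_subgroup_coprod L hL S R hT
  have h1 : presLength H ≤ (L false).index * presLength (L true) +
      (L true).index * presLength (L false) := by
    refine (Nat.sInf_le ht).trans (htR.trans ?_)
    rw [Fintype.sum_bool]
    exact add_le_add (Nat.mul_le_mul_left _ (hR _)) (Nat.mul_le_mul_left _ (hR _))
  refine (stablePresLength_le (H := H) (by rw [hH]; exact mul_ne_zero (hL _) (hL _))).trans ?_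
  have h2 : ((L true).index : ℝ) ≠ 0 := Nat.cast_ne_zero.2 (hL _)
  have h3 : ((L false).index : ℝ) ≠ 0 := Nat.cast_ne_zero.2 (hL _)
  rw [hH, Nat.cast_mul, div_add_div _ _ h2 h3, mul_comm (presLength (L true) : ℝ)]
  gcongr
  exact_mod_cast h1

theorem stablePresLength_coprod (h : ∀ i, FinitelyPresentable (freeFactor G₁ G₂ i)) :
    stablePresLength (Coprod G₁ G₂) =
      stablePresLength (freeFactor G₁ G₂ true) + stablePresLength (freeFactor G₁ G₂ false) := by
  refine le_antisymm ?_ (le_stablePresLength fun H hH => ?_)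
  · rw [← sub_le_iff_le_add]
    refine le_stablePresLength fun L₁ hL₁ => ?_
    rw [sub_le_comm]
    refine le_stablePresLength fun L₂ hL₂ => ?_
    rw [sub_le_iff_le_add']
    exact stablePresLength_coprod_le h
      (fun | true => L₁ | false => L₂) (fun | true => hL₁ | false => hL₂)
  · rw [le_div_iff₀' (by positivity), ← Fintype.sum_bool
      fun i => stablePresLength (freeFactor G₁ G₂ i)]
    exact index_mul_sum_stablePresLength_le hH ((FinitelyPresentable.coprod h).subgroup H hH)

end Coprod

/-- Stable presentation length is additive under free products. -/
theorem stablePresLength_freeProduct (G₁ G₂ : Type*) [Group G₁] [Group G₂]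
    (h₁ : FinitelyPresentable G₁) (h₂ : FinitelyPresentable G₂) :
    stablePresLength (Monoid.Coprod G₁ G₂) =
      stablePresLength G₁ + stablePresLength G₂ := by
  let e₁ : G₁ ≃* freeFactor G₁ G₂ true := MonoidHom.ofInjective Coprod.inl_injective
  let e₂ : G₂ ≃* freeFactor G₁ G₂ false := MonoidHom.ofInjective Coprod.inr_injective
  rw [stablePresLength_congr e₁, stablePresLength_congr e₂]
  refine stablePresLength_coprod fun i => ?_
  rw [FinitelyPresentable]
  cases i
  · rwa [← presLengthValues_congr e₂]
  · rwa [← presLengthValues_congr e₁]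
end

section
/- If G is a finitely presentable group without 2-torsion (no element of order 2), then T(G) ≥ log₃ |Tor(G/[G,G])|, where |Tor(G/[G,G])| denotes the order of the torsion subgroup of the abelianization of G. -/
/-- The determinant of an integer matrix is bounded by the product of the `ℓ¹`-norms of its rows. -/
theorem Matrix.natAbs_det_le_prod_sum_natAbs {n : Type*} [Fintype n] [DecidableEq n]
    (M : Matrix n n ℤ) : M.det.natAbs ≤ ∏ i, ∑ j, (M i j).natAbs := by
  rw [← Matrix.det_transpose, Matrix.det_apply, Finset.prod_univ_sum, Fintype.piFinset_univ]
  refine (Int.natAbs_sum_le _ _).trans ?_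
  calc ∑ σ : Equiv.Perm n, (Equiv.Perm.sign σ • ∏ i, M.transpose (σ i) i).natAbs
      = ∑ σ : Equiv.Perm n, ∏ i, (M i (σ i)).natAbs := by
        refine Finset.sum_congr rfl fun σ _ ↦ ?_
        rw [Units.smul_def, smul_eq_mul, Int.natAbs_mul, Int.units_natAbs, one_mul,
          ← Int.natAbsHom_apply, map_prod]
        rfl
    _ = ∑ p ∈ Finset.univ.image (fun σ : Equiv.Perm n ↦ (σ : n → n)),
          ∏ i, (M i (p i)).natAbs :=
        (Finset.sum_image (f := fun p : n → n ↦ ∏ i, (M i (p i)).natAbs)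
          (DFunLike.coe_injective (F := Equiv.Perm n)).injOn).symm
    _ ≤ _ := Finset.sum_le_sum_of_subset (Finset.subset_univ _)

/-- Among the vectors `v i` and the standard unit vectors one can select a `ℚ`-basis of `ℚⁿ`
whose members of the form `v i` span all the `v i`. -/
theorem exists_rat_basis_extending {ι : Type*} {n : ℕ} (v : ι → Fin n → ℚ) :
    ∃ (J : Set (ι ⊕ Fin n)) (b : Module.Basis J ℚ (Fin n → ℚ)),
      (∀ j : J, b j = Sum.elim v (fun k ↦ Pi.single k 1) j) ∧
      Submodule.span ℚ (Set.range v) ≤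
        Submodule.span ℚ (b '' {j | (j : ι ⊕ Fin n).isLeft}) := by
  set w : ι ⊕ Fin n → Fin n → ℚ := Sum.elim v (fun k ↦ Pi.single k 1) with hw
  obtain ⟨I, hIl, -, hIv, hI⟩ := exists_linearIndepOn_extension (K := ℚ) (v := w)
    (linearIndepOn_empty ℚ w) (Set.empty_subset (Set.range Sum.inl))
  obtain ⟨J, -, hIJ, hJu, hJ⟩ := exists_linearIndepOn_extension hI (Set.subset_univ I)
  have hJ' : LinearIndependent ℚ (fun j : J ↦ w j) := hJ
  have hspan : ⊤ ≤ Submodule.span ℚ (Set.range fun j : J ↦ w j) := by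
    rw [← (Pi.basisFun ℚ (Fin n)).span_eq, Submodule.span_le]
    rintro _ ⟨k, rfl⟩
    have := hJu ⟨Sum.inr k, trivial, rfl⟩
    rw [Set.image_eq_range] at this
    simpa [hw] using this
  refine ⟨J, Module.Basis.mk hJ' hspan, fun j ↦ by simp, Submodule.span_le.2 ?_⟩
  rintro _ ⟨i, rfl⟩
  have := hIv ⟨Sum.inl i, ⟨i, rfl⟩, rfl⟩
  refine Submodule.span_mono ?_ this
  rintro _ ⟨x, hx, rfl⟩
  obtain ⟨i, rfl⟩ := hIl hx
  exact ⟨⟨_, hIJ hx⟩, rfl, by simp⟩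

/-- The torsion of `ℤⁿ / ⟨v i⟩` is bounded by the product of the `ℓ¹`-norms of the `v i ≠ 0`. -/
theorem card_torsion_quotient_span_le {ι : Type*} [Fintype ι] {n : ℕ} (v : ι → Fin n → ℤ) :
    Nat.card (Submodule.torsion ℤ ((Fin n → ℤ) ⧸ Submodule.span ℤ (Set.range v))) ≤
      ∏ i, max 1 (∑ j, (v i j).natAbs) := by
  classical
  let toRat : (Fin n → ℤ) →ₗ[ℤ] (Fin n → ℚ) := (Algebra.linearMap ℤ ℚ).compLeft (Fin n)
  let w : ι ⊕ Fin n → Fin n → ℤ := Sum.elim v (fun k ↦ Pi.single k 1)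
  obtain ⟨J, b, hb, hspan⟩ := exists_rat_basis_extending (fun i ↦ toRat (v i))
  have hbw (j : J) : b j = toRat (w j) := by
    rw [hb]
    rcases j with ⟨i | k, _⟩
    · rfl
    · ext l
      by_cases h : l = k <;> simp [w, toRat, h]
  have hwli : LinearIndependent ℤ (fun j : J ↦ w j) := by
    refine LinearIndependent.of_comp toRat ?_
    have := b.linearIndependent.restrict_scalars' ℤ
    convert this using 1
    exact funext fun j ↦ (hbw j).symm
  let e : J ≃ Fin n := Fintype.equivOfCardEq (by
    rw [← Module.finrank_eq_card_basis b]; simp)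
  let N : Submodule ℤ (Fin n → ℤ) := Submodule.span ℤ (Set.range fun j : J ↦ w j)
  let bN : Module.Basis (Fin n) ℤ N := (Module.Basis.span hwli).reindex e
  have hbN (k : Fin n) : (bN k : Fin n → ℤ) = w (e.symm k) := by
    simp [bN, Module.Basis.span_apply]
  have hdet := Submodule.natAbs_det_basis_change (Pi.basisFun ℤ (Fin n)) N bN
  have : Finite ((Fin n → ℤ) ⧸ N) := N.finiteQuotientOfFreeOfRankEq (by
    rw [Module.finrank_eq_card_basis bN, Module.finrank_eq_card_basis (Pi.basisFun ℤ (Fin n))])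
  have hcard_le : Nat.card ((Fin n → ℤ) ⧸ N) ≤ ∏ i, max 1 (∑ j, (v i j).natAbs) := by
    rw [← hdet, Module.Basis.det_apply, ← Matrix.det_transpose]
    refine (Matrix.natAbs_det_le_prod_sum_natAbs _).trans ?_
    calc _ = ∏ j : J, ∑ k, (w j k).natAbs := by
          refine Fintype.prod_equiv e.symm _ _ fun i ↦ ?_
          simp [Module.Basis.toMatrix_apply, hbN]
      _ ≤ ∏ j : J, max 1 (∑ k, (w j k).natAbs) :=
          Finset.prod_le_prod' fun _ _ ↦ le_max_right _ _
      _ ≤ ∏ j, max 1 (∑ k, (w j k).natAbs) := by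
          rw [Finset.prod_set_coe J (f := fun j ↦ max 1 (∑ k, (w j k).natAbs))]
          exact Finset.prod_le_prod_of_subset_of_one_le' (Finset.subset_univ _)
            fun _ _ _ ↦ le_max_left _ _
      _ = _ := by
          rw [Fintype.prod_sum_type]
          simp [w, Pi.single_apply, apply_ite Int.natAbs]
  refine le_trans ?_ hcard_le
  have key (x : Fin n → ℤ) (hxN : x ∈ N) (c : ℤ) (hc : c ≠ 0)
      (hcx : c • x ∈ Submodule.span ℤ (Set.range v)) :
      x ∈ Submodule.span ℤ (Set.range v) := by
    let y := (Module.Basis.span hwli).repr ⟨x, hxN⟩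
    have hy : x = ∑ j, y j • w j := by
      have := congrArg Subtype.val ((Module.Basis.span hwli).sum_repr ⟨x, hxN⟩)
      simpa [Module.Basis.span_apply] using this.symm
    have hQ : toRat x ∈ Submodule.span ℚ (Set.range fun i ↦ toRat (v i)) := by
      have h1 : toRat (c • x) ∈ Submodule.span ℚ (Set.range fun i ↦ toRat (v i)) := by
        have := Submodule.mem_map_of_mem (f := toRat) hcx
        rw [Submodule.map_span, ← Set.range_comp] at this
        exact Submodule.span_le_restrictScalars ℤ ℚ _ this
      have h2 : toRat x = (c : ℚ)⁻¹ • toRat (c • x) := by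
        rw [map_smul, ← Int.cast_smul_eq_zsmul ℚ, inv_smul_smul₀ (by exact_mod_cast hc)]
      rw [h2]
      exact Submodule.smul_mem _ _ h1
    have hsupp := b.mem_span_image.1 (hspan hQ)
    have hrepr (j : J) : b.repr (toRat x) j = y j := by
      have : toRat x = ∑ j, (y j : ℚ) • b j := by
        rw [hy, map_sum]
        exact Finset.sum_congr rfl fun i _ ↦ by
          rw [map_smul, hbw, Int.cast_smul_eq_zsmul]
      rw [this, b.repr_sum_self]
    rw [hy]
    refine Submodule.sum_mem _ fun j _ ↦ ?_
    by_cases hj : y j = 0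
    · simp [hj]
    · have : (j : ι ⊕ Fin n).isLeft := hsupp (by simpa [hrepr] using hj)
      obtain ⟨i, hi⟩ := Sum.isLeft_iff.1 this
      rw [hi]
      exact Submodule.smul_mem _ _ (Submodule.subset_span ⟨i, rfl⟩)
  refine Nat.card_le_card_of_injective
    (fun t ↦ (Submodule.Quotient.mk (Quotient.out t.1) : (Fin n → ℤ) ⧸ N)) fun s t hst ↦ ?_
  obtain ⟨c, hc⟩ := (Submodule.torsion ℤ _).sub_mem s.2 t.2
  have hout (q : (Fin n → ℤ) ⧸ Submodule.span ℤ (Set.range v)) :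
      Submodule.Quotient.mk (Quotient.out q) = q := Quotient.out_eq q
  apply Subtype.ext
  rw [← hout s.1, ← hout t.1]
  rw [← hout s.1, ← hout t.1, ← Submodule.Quotient.mk_sub, Submonoid.smul_def,
    ← Submodule.Quotient.mk_smul, Submodule.Quotient.mk_eq_zero] at hc
  exact (Submodule.Quotient.eq _).2
    (key _ ((Submodule.Quotient.eq _).1 hst) c (nonZeroDivisors.ne_zero c.2) hc)

/-- In a group without involutions one can choose signed coordinates for the members of a finite
family, identifying those members which agree up to inversion. -/
theorem exists_signed_coordinates {G A : Type*} [Group G] [CommGroup A]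
    (h2 : ∀ x : G, orderOf x ≠ 2) {n : ℕ} (g : Fin n → G) (f : G →* A) :
    ∃ τ : G → Fin n → ℤ, (∀ x, τ x⁻¹ = -τ x) ∧ (∀ x, ∑ j, (τ x j).natAbs ≤ 1) ∧
      ∀ i, ∏ j, f (g j) ^ τ (g i) j = f (g i) := by
  classical
  let rep (j : Fin n) : Prop := ∀ i < j, g i ≠ g j ∧ g i ≠ (g j)⁻¹
  let τ (x : G) (j : Fin n) : ℤ :=
    if rep j then (if g j = x then 1 else 0) - (if g j = x⁻¹ then 1 else 0) else 0
  have τ_eq_zero {x : G} {j : Fin n} (h : ¬ (rep j ∧ (g j = x ∨ g j = x⁻¹))) : τ x j = 0 := by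
    grind
  have rep_unique {x : G} {j k : Fin n} (hj : rep j ∧ (g j = x ∨ g j = x⁻¹))
      (hk : rep k ∧ (g k = x ∨ g k = x⁻¹)) : k = j := by
    have hjk : g j = g k ∨ g j = (g k)⁻¹ := by
      rcases hj.2 with h | h <;> rcases hk.2 with h' | h' <;> simp [h, h']
    have hkj : g k = g j ∨ g k = (g j)⁻¹ := by
      rcases hj.2 with h | h <;> rcases hk.2 with h' | h' <;> simp [h, h']
    rcases lt_trichotomy k j with h | h | h
    · exact absurd hkj (not_or.2 (hj.1 k h))
    · exact h
    · exact absurd hjk (not_or.2 (hk.1 j h))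
  refine ⟨τ, fun x ↦ ?_, fun x ↦ ?_, fun i ↦ ?_⟩
  · ext j
    by_cases h : rep j <;> simp [τ, h]
  · by_cases h : ∃ j, rep j ∧ (g j = x ∨ g j = x⁻¹)
    · obtain ⟨j, hj⟩ := h
      rw [Finset.sum_eq_single j
        (fun k _ hk ↦ by rw [τ_eq_zero fun h ↦ hk (rep_unique hj h), Int.natAbs_zero])
        (by simp)]
      simp only [τ]
      split_ifs <;> simp
    · push Not at h
      rw [Finset.sum_eq_zero fun k _ ↦ by rw [τ_eq_zero (by grind), Int.natAbs_zero]]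
      exact zero_le_one
  · obtain ⟨j, hj, hmin⟩ := wellFounded_lt.has_min {j | g j = g i ∨ g j = (g i)⁻¹} ⟨i, Or.inl rfl⟩
    have hrep : rep j ∧ (g j = g i ∨ g j = (g i)⁻¹) := by
      refine ⟨fun k hk ↦ not_or.1 fun h ↦ hmin k ?_ hk, hj⟩
      rcases hj with hj | hj <;> rcases h with h | h <;> simp [h, hj]
    rw [Finset.prod_eq_single j
      (fun k _ hk ↦ by rw [τ_eq_zero fun h ↦ hk (rep_unique hrep h), zpow_zero]) (by simp)]
    by_cases hi : g i = (g i)⁻¹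
    · have hone : g i = 1 := by
        by_contra hne
        refine h2 (g i) (orderOf_eq_prime ?_ hne)
        rw [pow_two]
        nth_rewrite 1 [hi]
        exact inv_mul_cancel _
      have : g j = 1 := by simpa [hone] using hj
      simp [this, hone]
    · rcases hj with hj | hj
      · simp [τ, hrep.1, hj, hi]
      · simp [τ, hrep.1, hj, Ne.symm hi]

/-- Under signed coordinates `τ`, a relator of length `k` has a coordinate vector which vanishes if
`k ≤ 2` and has `ℓ¹`-norm at most `k ≤ 3 ^ (k - 2)` otherwise. -/
theorem sum_natAbs_lift_le {G : Type*} [Group G] {n : ℕ} (g : Fin n → G) (τ : G → Fin n → ℤ)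
    (hinv : ∀ x, τ x⁻¹ = -τ x) (hnorm : ∀ x, ∑ j, (τ x j).natAbs ≤ 1)
    (r : FreeGroup (Fin n)) (hr : FreeGroup.lift g r = 1) :
    max 1 (∑ j, (((FreeGroup.lift fun i ↦ Multiplicative.ofAdd (τ (g i))) r).toAdd j).natAbs) ≤
      3 ^ (r.norm - 2) := by
  let letter (p : Fin n × Bool) : G := cond p.2 (g p.1) (g p.1)⁻¹
  have hG : FreeGroup.lift g r = (r.toWord.map letter).prod := by
    conv_lhs => rw [← FreeGroup.mk_toWord (x := r)]
    exact FreeGroup.lift_mk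
  have hZ : ((FreeGroup.lift fun i ↦ Multiplicative.ofAdd (τ (g i))) r).toAdd =
      (r.toWord.map fun p ↦ τ (letter p)).sum := by
    conv_lhs => rw [← FreeGroup.mk_toWord (x := r)]
    rw [FreeGroup.lift_mk, toAdd_list_sum, List.map_map]
    congr 2
    funext ⟨i, b⟩
    cases b <;> simp [letter, hinv]
  have hbound (L : List (Fin n × Bool)) :
      ∑ j, ((L.map fun p ↦ τ (letter p)).sum j).natAbs ≤ L.length := by
    induction L with
    | nil => simp
    | cons p L ih =>
      simp only [List.map_cons, List.sum_cons, Pi.add_apply, List.length_cons]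
      calc _ ≤ ∑ j, ((τ (letter p) j).natAbs + ((L.map fun p ↦ τ (letter p)).sum j).natAbs) :=
            Finset.sum_le_sum fun _ _ ↦ Int.natAbs_add_le _ _
        _ ≤ _ := by
            rw [Finset.sum_add_distrib]
            linarith [hnorm (letter p)]
  rw [hZ, FreeGroup.norm]
  rw [hG] at hr
  have hone : τ 1 = 0 := self_eq_neg.1 (by simpa using hinv 1)
  refine max_le (Nat.one_le_pow _ _ (by norm_num)) ?_
  have hL := hbound r.toWord
  match hw : r.toWord with
  | [] => simp
  | [p] =>
    have hp : letter p = 1 := by simpa [hw] using hr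
    simp [hp, hone]
  | [p, q] =>
    have hp : letter q = (letter p)⁻¹ := by
      rw [hw] at hr
      exact eq_inv_of_mul_eq_one_right (by simpa using hr)
    simp [hp, hinv]
  | p :: q :: s :: L =>
    rw [hw] at hL
    refine hL.trans ?_
    change L.length + 3 ≤ 3 ^ (L.length + 1)
    generalize L.length = k
    induction k with
    | zero => simp
    | succ k ih => rw [pow_succ]; omega

/-- The bound on the torsion of the abelianization given by an arbitrary finite presentation. -/
theorem card_torsion_abelianization_le {G : Type*} [Group G] (h2 : ∀ x : G, orderOf x ≠ 2)
    {n : ℕ} (rels : List (FreeGroup (Fin n))) (e : G ≃* PresentedGroup {r | r ∈ rels}) :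
    Nat.card (CommGroup.torsion (Abelianization G)) ≤
      3 ^ (rels.map fun r ↦ r.norm - 2).sum := by
  let g (i : Fin n) : G := e.symm (PresentedGroup.of i)
  obtain ⟨τ, hinv, hnorm, hτ⟩ := exists_signed_coordinates h2 g (Abelianization.of (G := G))
  have hg : FreeGroup.lift g = e.symm.toMonoidHom.comp (PresentedGroup.mk {r | r ∈ rels}) := by
    ext i; simp [g, PresentedGroup.of]
  have hrel (r) (hr : r ∈ rels) : FreeGroup.lift g r = 1 := by
    rw [hg]
    have : PresentedGroup.mk {r | r ∈ rels} r = 1 :=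
      (QuotientGroup.eq_one_iff r).2 (Subgroup.subset_normalClosure hr)
    simp [this]
  let F : FreeGroup (Fin n) →* Multiplicative (Fin n → ℤ) :=
    FreeGroup.lift fun i ↦ Multiplicative.ofAdd (τ (g i))
  let v (k : Fin rels.length) : Fin n → ℤ := (F (rels.get k)).toAdd
  let V := Submodule.span ℤ (Set.range v)
  let Q := (Fin n → ℤ) ⧸ V
  have hFrel : ∀ r ∈ {r | r ∈ rels},
      FreeGroup.lift (fun i ↦ Multiplicative.ofAdd (V.mkQ (τ (g i)))) r = 1 := by
    intro r hr
    have : FreeGroup.lift (fun i ↦ Multiplicative.ofAdd (V.mkQ (τ (g i)))) =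
        (AddMonoidHom.toMultiplicative V.mkQ.toAddMonoidHom).comp F := by
      ext i; simp [F]
    rw [this]
    obtain ⟨k, hk, rfl⟩ := List.mem_iff_getElem.1 hr
    have : V.mkQ (v ⟨k, hk⟩) = 0 :=
      (Submodule.Quotient.mk_eq_zero V).2 (Submodule.subset_span ⟨_, rfl⟩)
    exact congrArg Multiplicative.ofAdd this
  let ρ : Abelianization G →* Multiplicative Q :=
    Abelianization.lift ((PresentedGroup.toGroup hFrel).comp e.toMonoidHom)
  let Λ : (Fin n → ℤ) →+ Additive (Abelianization G) :=
    { toFun := fun c ↦ Additive.ofMul (∏ j, Abelianization.of (g j) ^ c j)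
      map_zero' := by simp
      map_add' := fun c d ↦ by simp [zpow_add, Finset.prod_mul_distrib] }
  have hΛF (r : FreeGroup (Fin n)) :
      Λ (F r).toAdd = Additive.ofMul (Abelianization.of (FreeGroup.lift g r)) := by
    have : (AddMonoidHom.toMultiplicativeLeft Λ).comp F =
        Abelianization.of.comp (FreeGroup.lift g) := by
      ext i; simpa [F, Λ] using hτ i
    exact congrArg Additive.ofMul (DFunLike.congr_fun this r)
  have hVΛ : V ≤ LinearMap.ker Λ.toIntLinearMap := by
    refine Submodule.span_le.2 ?_
    rintro _ ⟨k, rfl⟩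
    change Λ (F (rels.get k)).toAdd = 0
    rw [hΛF, hrel _ (List.get_mem rels k)]
    simp
  have hρinj : Function.Injective ρ := by
    let lam := AddMonoidHom.toMultiplicativeLeft (V.liftQ Λ.toIntLinearMap hVΛ).toAddMonoidHom
    have hcomp : (lam.comp ρ).comp (Abelianization.of.comp e.symm.toMonoidHom) =
        Abelianization.of.comp e.symm.toMonoidHom := by
      refine PresentedGroup.ext fun i ↦ ?_
      have : ρ (Abelianization.of (e.symm (PresentedGroup.of i))) =
          Multiplicative.ofAdd (V.mkQ (τ (g i))) := by
        simp [ρ]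
      simp only [MonoidHom.comp_apply, MulEquiv.coe_toMonoidHom, this]
      exact hτ i
    have hid : lam.comp ρ = MonoidHom.id _ := by
      refine Abelianization.hom_ext _ _ (MonoidHom.ext fun x ↦ ?_)
      simpa using DFunLike.congr_fun hcomp (e x)
    exact Function.LeftInverse.injective (g := lam) fun x ↦ DFunLike.congr_fun hid x
  have hfin : Finite (Submodule.torsion ℤ Q) :=
    Module.finite_of_fg_torsion _ Submodule.torsion_isTorsion
  have htors (x : CommGroup.torsion (Abelianization G)) :
      (ρ x.1).toAdd ∈ Submodule.torsion ℤ Q := by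
    obtain ⟨m, hm, hx⟩ := isOfFinOrder_iff_pow_eq_one.1 x.2
    refine ⟨⟨m, mem_nonZeroDivisors_of_ne_zero (by exact_mod_cast hm.ne')⟩, ?_⟩
    have : (ρ (x.1 ^ m)).toAdd = 0 := by rw [hx, map_one, toAdd_one]
    simpa [Submonoid.smul_def] using this
  calc Nat.card (CommGroup.torsion (Abelianization G))
      ≤ Nat.card (Submodule.torsion ℤ Q) :=
        Nat.card_le_card_of_injective (fun x ↦ (⟨_, htors x⟩ : Submodule.torsion ℤ Q))
          fun x y h ↦ Subtype.ext (hρinj (congrArg Subtype.val h))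
    _ ≤ ∏ k, max 1 (∑ j, (v k j).natAbs) := card_torsion_quotient_span_le v
    _ ≤ ∏ k : Fin rels.length, 3 ^ ((rels.get k).norm - 2) :=
        Finset.prod_le_prod' fun k _ ↦
          sum_natAbs_lift_le g τ hinv hnorm _ (hrel _ (List.get_mem rels k))
    _ = _ := by
        rw [Finset.prod_pow_eq_pow_sum]
        congr 1
        exact Fin.sum_univ_fun_getElem rels fun r ↦ r.norm - 2

/-- If `G` is finitely presentable without 2-torsion, then
`T(G) ≥ log₃ |Tor(G/[G,G])|`. -/
theorem presLength_ge_logb_torsion (G : Type*) [Group G]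
    (hG : FinitelyPresentable G) (h2 : ∀ x : G, orderOf x ≠ 2) :
    Real.logb 3 (Nat.card (CommGroup.torsion (Abelianization G))) ≤
      (presLength G : ℝ) := by
  obtain ⟨n, rels, ⟨e⟩, ht⟩ := Nat.sInf_mem hG
  have hle : Nat.card (CommGroup.torsion (Abelianization G)) ≤ 3 ^ presLength G := by
    rw [presLength, ht]
    exact card_torsion_abelianization_le h2 rels e
  rcases Nat.eq_zero_or_pos (Nat.card (CommGroup.torsion (Abelianization G))) with h0 | hpos
  · simp [h0]
  · rw [Real.logb_le_iff_le_rpow (by norm_num) (by exact_mod_cast hpos), Real.rpow_natCast]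
    exact_mod_cast hle
end
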